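/- arXiv:1409.2588 — 2 statements merged into one kernel-verified Lean document; each statement's English description precedes it below -/
import Mathlib

section
/- Let d ≥ 2 and let α ∈ ℂ with Re(α) > 0. Define σ^α(x) = (1/Γ(α)) (1 − |x|²)_+^{α−1} for x ∈ ℝ^d. Then there is a constant C (depending on d and α) such that the Fourier transform \widehat{σ^α}(ξ) = ∫_{ℝ^d} σ^α(x) e^{−2πi x·ξ} dx satisfies |\widehat{σ^α}(ξ)| ≤ C (1 + |ξ|)^{−(d−1)/2 − Re(α)} for all ξ ∈ ℝ^d. -/
open MeasureTheory Complex
open scoped ENNReal RealInnerProductSpace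

/-- The function `σ^α(x) = (1/Γ(α)) (1 - |x|²)_+^{α-1}` on `ℝ^d`. -/
noncomputable def sigmaAlpha (d : ℕ) (α : ℂ) (x : EuclideanSpace ℝ (Fin d)) : ℂ :=
  (1 / Complex.Gamma α) * ((max (1 - ‖x‖ ^ 2) 0 : ℝ) : ℂ) ^ (α - 1)

/-- A real power of `w` is at most the sum of the powers of any two positive bounds of `w`. -/
lemma Real.rpow_le_rpow_add_rpow {l w u : ℝ} (p : ℝ) (hl : 0 < l) (hlw : l ≤ w) (hwu : w ≤ u) :
    w ^ p ≤ l ^ p + u ^ p := by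
  have hw : 0 < w := hl.trans_le hlw
  have hu : 0 < u := hw.trans_le hwu
  have h1 := Real.rpow_nonneg hl.le p
  have h2 := Real.rpow_nonneg hu.le p
  rcases le_total 0 p with hp | hp
  · linarith [Real.rpow_le_rpow hw.le hwu hp]
  · linarith [Real.rpow_le_rpow_of_nonpos hl hlw hp]

lemma Complex.norm_cpow_le_mul_exp (w s : ℂ) :
    ‖w ^ s‖ ≤ Real.exp (Real.pi * |s.im|) * ‖w‖ ^ s.re := by
  refine (Complex.norm_cpow_le w s).trans ?_
  rw [div_eq_mul_inv, ← Real.exp_neg, mul_comm]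
  gcongr
  calc -(w.arg * s.im) ≤ |w.arg * s.im| := neg_le_abs _
    _ = |w.arg| * |s.im| := abs_mul _ _
    _ ≤ _ := by gcongr; exact Complex.abs_arg_le_pi w

lemma Complex.norm_cpow_le_of_norm_mem {w : ℂ} (s : ℂ) {l u : ℝ} (hl : 0 < l) (hlw : l ≤ ‖w‖)
    (hwu : ‖w‖ ≤ u) :
    ‖w ^ s‖ ≤ Real.exp (Real.pi * |s.im|) * (l ^ s.re + u ^ s.re) :=
  (Complex.norm_cpow_le_mul_exp w s).trans <| by
    gcongr
    exact Real.rpow_le_rpow_add_rpow _ hl hlw hwu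

lemma intervalIntegrable_one_sub_sq_rpow {p : ℝ} (hp : -1 < p) :
    IntervalIntegrable (fun x : ℝ => (1 - x ^ 2) ^ p) volume (-1) 1 := by
  have h1 : IntervalIntegrable (fun x : ℝ => (1 - x ^ 2) ^ p) volume 0 1 := by
    have h : IntervalIntegrable (fun x : ℝ => (1 - x) ^ p) volume 0 1 := by
      simpa using ((intervalIntegral.intervalIntegrable_rpow' (a := 0) (b := 1) hp).comp_sub_left
        1).symm
    have hc : ContinuousOn (fun x : ℝ => (1 + x) ^ p) (Set.uIcc 0 1) := by
      intro x hx
      rw [Set.uIcc_of_le zero_le_one] at hx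
      refine ContinuousAt.continuousWithinAt ?_
      refine ContinuousAt.rpow_const (by fun_prop) (Or.inl ?_)
      linarith [hx.1]
    refine (h.mul_continuousOn hc).congr ?_
    intro x hx
    rw [Set.uIoc_of_le zero_le_one] at hx
    change (1 - x) ^ p * (1 + x) ^ p = _
    rw [← Real.mul_rpow (by linarith [hx.2]) (by linarith [hx.1])]
    congr 1
    ring
  have h2 : IntervalIntegrable (fun x : ℝ => (1 - x ^ 2) ^ p) volume (-1) 0 := by
    have := ((IntervalIntegrable.iff_comp_neg (by finiteness)).mp h1).symm
    simpa using this
  exact h2.trans h1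

/-- The holomorphic integrand of the Poisson integral for Bessel functions. -/
noncomputable def poissonIntegrand (β : ℂ) (t : ℝ) (z : ℂ) : ℂ :=
  (1 - z ^ 2) ^ (β - 1) * Complex.exp (t * z * Complex.I)

lemma re_one_sub_sq (x y : ℝ) : (1 - ((x : ℂ) + y * Complex.I) ^ 2).re = 1 - x ^ 2 + y ^ 2 := by
  simp [pow_two]
  ring

lemma im_one_sub_sq (x y : ℝ) : (1 - ((x : ℂ) + y * Complex.I) ^ 2).im = -(2 * x * y) := by
  simp [pow_two]
  ring

lemma norm_one_sub_sq (x y : ℝ) : ‖1 - ((x : ℂ) + y * Complex.I) ^ 2‖ =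
    √((1 - x ^ 2 + y ^ 2) ^ 2 + (2 * x * y) ^ 2) := by
  rw [Complex.norm_eq_sqrt_sq_add_sq, re_one_sub_sq, im_one_sub_sq, neg_sq]

lemma norm_one_sub_sq_le {x y : ℝ} (hx : x ∈ Set.Icc (-1) 1) (hy : y ∈ Set.Icc 0 1) :
    ‖1 - ((x : ℂ) + y * Complex.I) ^ 2‖ ≤ 5 := by
  rw [norm_one_sub_sq]
  refine Real.sqrt_le_iff.mpr ⟨by norm_num, ?_⟩
  have hx2 : x ^ 2 ≤ 1 := by nlinarith [hx.1, hx.2]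
  have hy2 : y ^ 2 ≤ 1 := by nlinarith [hy.1, hy.2]
  nlinarith [sq_nonneg x, sq_nonneg y, mul_nonneg (sq_nonneg x) (sq_nonneg y)]

lemma re_le_norm_one_sub_sq (x y : ℝ) :
    1 - x ^ 2 + y ^ 2 ≤ ‖1 - ((x : ℂ) + y * Complex.I) ^ 2‖ := by
  rw [← re_one_sub_sq]
  exact Complex.re_le_norm _

lemma norm_exp_mul_add_mul_I (t x y : ℝ) :
    ‖Complex.exp (t * ((x : ℂ) + y * Complex.I) * Complex.I)‖ = Real.exp (-(t * y)) := by
  rw [Complex.norm_exp]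
  simp

lemma differentiableAt_poissonIntegrand (β : ℂ) (t : ℝ) {z : ℂ} (hz : 1 - z ^ 2 ∈ slitPlane) :
    DifferentiableAt ℂ (poissonIntegrand β t) z := by
  unfold poissonIntegrand
  refine DifferentiableAt.mul ?_ (by fun_prop)
  exact DifferentiableAt.cpow_const (by fun_prop) hz

lemma norm_integral_poissonIntegrand_side_le {β : ℂ} (hβ : 0 < β.re) {t : ℝ} (ht : 0 ≤ t)
    {ε : ℝ} (hε : 0 < ε) (hε1 : ε ≤ 1) {s : ℝ} (hs : s ^ 2 = 1) :
    ‖∫ y : ℝ in ε..1, poissonIntegrand β t (s + y * Complex.I)‖ ≤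
      Real.exp (Real.pi * |β.im|) * (2 ^ (β.re - 1) + 3 ^ (β.re - 1)) * Real.exp 1 *
        ((1 / (1 + t)) ^ β.re * Real.Gamma β.re) := by
  set K := Real.exp (Real.pi * |β.im|) * (2 ^ (β.re - 1) + 3 ^ (β.re - 1)) * Real.exp 1 with hK
  have hK0 : 0 ≤ K := by positivity
  have ht1 : 0 < 1 + t := by linarith
  have hint : IntegrableOn (fun y : ℝ => K * (y ^ (β.re - 1) * Real.exp (-((1 + t) * y))))
      (Set.Ioi 0) := by
    have := integrableOn_rpow_mul_exp_neg_mul_rpow (p := 1) (s := β.re - 1) (b := 1 + t)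
      (by linarith) one_pos ht1
    simp only [Real.rpow_one, neg_mul] at this
    exact this.const_mul K
  have hsub : Set.Ioc ε 1 ⊆ Set.Ioi 0 := fun y hy => hε.trans hy.1
  calc _ ≤ ∫ y : ℝ in ε..1, K * (y ^ (β.re - 1) * Real.exp (-((1 + t) * y))) := by
        refine intervalIntegral.norm_integral_le_of_norm_le hε1 (Filter.Eventually.of_forall ?_) ?_
        · intro y hy
          have hy0 : 0 < y := hε.trans hy.1
          have hn : ‖1 - ((s : ℂ) + y * Complex.I) ^ 2‖ = y * √(y ^ 2 + 4) := by
            rw [norm_one_sub_sq, ← Real.sqrt_sq hy0.le, ← Real.sqrt_mul (sq_nonneg _),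
              Real.sqrt_sq hy0.le]
            congr 1
            linear_combination (-1 + s ^ 2 - 2 * y ^ 2 + 4 * y ^ 2) * hs
          have h2 : 2 * y ≤ y * √(y ^ 2 + 4) := by
            rw [mul_comm]
            gcongr
            exact Real.le_sqrt_of_sq_le (by nlinarith)
          have h3 : y * √(y ^ 2 + 4) ≤ 3 * y := by
            rw [mul_comm 3]
            gcongr
            exact Real.sqrt_le_iff.mpr ⟨by norm_num, by nlinarith [hy.2]⟩
          have hb := Complex.norm_cpow_le_of_norm_mem (w := 1 - ((s : ℂ) + y * Complex.I) ^ 2)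
            (β - 1) (l := 2 * y) (u := 3 * y) (by positivity) (hn ▸ h2) (hn ▸ h3)
          rw [Real.mul_rpow (by norm_num) hy0.le, Real.mul_rpow (by norm_num) hy0.le] at hb
          simp only [Complex.sub_re, Complex.one_re, Complex.sub_im, Complex.one_im,
            sub_zero] at hb
          have he : Real.exp (-(t * y)) ≤ Real.exp 1 * Real.exp (-((1 + t) * y)) := by
            rw [← Real.exp_add]
            gcongr
            linarith [hy.2]
          rw [poissonIntegrand, norm_mul, norm_exp_mul_add_mul_I]
          calc _ ≤ (Real.exp (Real.pi * |β.im|) *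
                (2 ^ (β.re - 1) * y ^ (β.re - 1) + 3 ^ (β.re - 1) * y ^ (β.re - 1))) *
                (Real.exp 1 * Real.exp (-((1 + t) * y))) := by gcongr
            _ = _ := by rw [hK]; ring
        · rw [intervalIntegrable_iff_integrableOn_Ioc_of_le hε1]
          exact hint.mono_set hsub
    _ ≤ ∫ y : ℝ in Set.Ioi 0, K * (y ^ (β.re - 1) * Real.exp (-((1 + t) * y))) := by
        rw [intervalIntegral.integral_of_le hε1]
        refine setIntegral_mono_set hint ?_ hsub.eventuallyLE
        filter_upwards [ae_restrict_mem measurableSet_Ioi] with y hy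
        have : (0 : ℝ) < y := hy
        positivity
    _ = _ := by
        rw [integral_const_mul, Real.integral_rpow_mul_exp_neg_mul_Ioi hβ ht1]

lemma Real.exp_neg_le_rpow {b t : ℝ} (hb : 0 < b) (ht : 0 ≤ t) :
    Real.exp (-t) ≤ Real.exp 1 * b ^ b * (1 / (1 + t)) ^ b := by
  have h1 : (1 + t) / b ≤ Real.exp ((1 + t) / b) := by
    linarith [Real.add_one_le_exp ((1 + t) / b)]
  have h2 := Real.rpow_le_rpow (by positivity) h1 hb.le
  rw [← Real.exp_mul, div_mul_cancel₀ _ hb.ne', Real.div_rpow (by positivity) hb.le,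
    div_le_iff₀ (by positivity)] at h2
  rw [Real.div_rpow zero_le_one (by positivity), Real.one_rpow, mul_one_div,
    le_div_iff₀ (by positivity)]
  calc Real.exp (-t) * (1 + t) ^ b ≤ Real.exp (-t) * (Real.exp (1 + t) * b ^ b) := by gcongr
    _ = _ := by
      rw [← mul_assoc, ← Real.exp_add]
      congr 2
      ring

lemma norm_integral_poissonIntegrand_top_le {β : ℂ} (hβ : 0 < β.re) {t : ℝ} (ht : 0 ≤ t) :
    ‖∫ x : ℝ in (-1)..1, poissonIntegrand β t (x + (1 : ℝ) * Complex.I)‖ ≤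
      Real.exp (Real.pi * |β.im|) * (1 ^ (β.re - 1) + 5 ^ (β.re - 1)) *
        (Real.exp 1 * β.re ^ β.re * (1 / (1 + t)) ^ β.re) * 2 := by
  have h : ∀ x ∈ Set.uIoc (-1 : ℝ) 1, ‖poissonIntegrand β t (x + (1 : ℝ) * Complex.I)‖ ≤
      Real.exp (Real.pi * |β.im|) * (1 ^ (β.re - 1) + 5 ^ (β.re - 1)) *
        (Real.exp 1 * β.re ^ β.re * (1 / (1 + t)) ^ β.re) := by
    intro x hx
    rw [Set.uIoc_of_le (by norm_num)] at hx
    have hl : 1 ≤ ‖1 - ((x : ℂ) + (1 : ℝ) * Complex.I) ^ 2‖ := by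
      have := re_le_norm_one_sub_sq x 1
      nlinarith [hx.1, hx.2]
    have hb := Complex.norm_cpow_le_of_norm_mem (β - 1) one_pos hl
      (norm_one_sub_sq_le ⟨hx.1.le, hx.2⟩ ⟨zero_le_one, le_rfl⟩)
    simp only [Complex.sub_re, Complex.one_re, Complex.sub_im, Complex.one_im, sub_zero] at hb
    rw [poissonIntegrand, norm_mul, norm_exp_mul_add_mul_I, mul_one]
    gcongr
    exact Real.exp_neg_le_rpow hβ ht
  refine (intervalIntegral.norm_integral_le_of_norm_le_const h).trans_eq ?_
  norm_num

lemma integral_poissonIntegrand_rect (β : ℂ) (t : ℝ) {ε : ℝ} (hε : 0 < ε) (hε1 : ε ≤ 1) :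
    ∫ x : ℝ in (-1)..1, poissonIntegrand β t (x + ε * Complex.I) =
      (∫ x : ℝ in (-1)..1, poissonIntegrand β t (x + (1 : ℝ) * Complex.I)) -
      Complex.I * (∫ y : ℝ in ε..1, poissonIntegrand β t ((1 : ℝ) + y * Complex.I)) +
      Complex.I * (∫ y : ℝ in ε..1, poissonIntegrand β t ((-1 : ℝ) + y * Complex.I)) := by
  have h := Complex.integral_boundary_rect_eq_zero_of_differentiableOn (poissonIntegrand β t)
    ⟨-1, ε⟩ ⟨1, 1⟩ ?_
  · simp only [smul_eq_mul] at h
    linear_combination h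
  · intro z hz
    rw [mem_reProdIm, Set.uIcc_of_le (by norm_num), Set.uIcc_of_le hε1] at hz
    obtain ⟨⟨h1, h2⟩, h3, -⟩ := hz
    simp only at h1 h2 h3
    refine (differentiableAt_poissonIntegrand β t (Or.inl ?_)).differentiableWithinAt
    rw [← Complex.re_add_im z, re_one_sub_sq]
    nlinarith

lemma tendsto_integral_poissonIntegrand {β : ℂ} (hβ : 0 < β.re) {t : ℝ} (ht : 0 ≤ t) :
    Filter.Tendsto (fun ε : ℝ => ∫ x : ℝ in (-1)..1, poissonIntegrand β t (x + ε * Complex.I))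
      (nhdsWithin 0 (Set.Ioc 0 1)) (nhds (∫ x : ℝ in (-1)..1, poissonIntegrand β t x)) := by
  refine intervalIntegral.tendsto_integral_filter_of_dominated_convergence
    (fun x => Real.exp (Real.pi * |β.im|) * ((1 - x ^ 2) ^ (β.re - 1) + 5 ^ (β.re - 1)))
    ?_ ?_ ?_ ?_
  · refine Filter.Eventually.of_forall fun ε => Measurable.aestronglyMeasurable ?_
    unfold poissonIntegrand
    fun_prop
  · filter_upwards [self_mem_nhdsWithin] with ε hε
    have hne : ∀ᵐ x : ℝ, x ≠ 1 := by simp [ae_iff]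
    filter_upwards [hne] with x hx1 hx
    rw [Set.uIoc_of_le (by norm_num)] at hx
    have hlt : x < 1 := lt_of_le_of_ne hx.2 hx1
    have hb := Complex.norm_cpow_le_of_norm_mem (w := 1 - ((x : ℂ) + ε * Complex.I) ^ 2)
      (β - 1) (l := 1 - x ^ 2) (by nlinarith [hx.1])
      ((by nlinarith : 1 - x ^ 2 ≤ 1 - x ^ 2 + ε ^ 2).trans (re_le_norm_one_sub_sq x ε))
      (norm_one_sub_sq_le ⟨hx.1.le, hx.2⟩ ⟨hε.1.le, hε.2⟩)
    simp only [Complex.sub_re, Complex.one_re, Complex.sub_im, Complex.one_im, sub_zero] at hb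
    rw [poissonIntegrand, norm_mul, norm_exp_mul_add_mul_I]
    refine (mul_le_of_le_one_right (norm_nonneg _) ?_).trans hb
    rw [Real.exp_le_one_iff]
    linarith [mul_nonneg ht hε.1.le]
  · exact ((intervalIntegrable_one_sub_sq_rpow (by linarith)).add
      intervalIntegrable_const).const_mul _
  · have hne : ∀ᵐ x : ℝ, x ≠ 1 := by simp [ae_iff]
    filter_upwards [hne] with x hx1 hx
    rw [Set.uIoc_of_le (by norm_num)] at hx
    have hlt : x < 1 := lt_of_le_of_ne hx.2 hx1
    have hs : 1 - (x : ℂ) ^ 2 ∈ slitPlane := by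
      refine Or.inl ?_
      have := re_one_sub_sq x 0
      simp only [Complex.ofReal_zero, zero_mul, add_zero] at this
      rw [this]
      nlinarith [hx.1]
    have hc : Filter.Tendsto (fun ε : ℝ => (x : ℂ) + ε * Complex.I) (nhds 0) (nhds (x : ℂ)) := by
      have : Continuous fun ε : ℝ => (x : ℂ) + ε * Complex.I := by fun_prop
      simpa using this.tendsto 0
    exact ((differentiableAt_poissonIntegrand β t hs).continuousAt.tendsto.comp hc).mono_left
      nhdsWithin_le_nhds

lemma exists_norm_integral_poissonIntegrand_le {β : ℂ} (hβ : 0 < β.re) :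
    ∃ C : ℝ, 0 < C ∧ ∀ t : ℝ, 0 ≤ t →
      ‖∫ x : ℝ in (-1)..1, poissonIntegrand β t x‖ ≤ C * (1 + t) ^ (-β.re) := by
  refine ⟨Real.exp (Real.pi * |β.im|) * (1 ^ (β.re - 1) + 5 ^ (β.re - 1)) *
    (Real.exp 1 * β.re ^ β.re) * 2 + 2 * (Real.exp (Real.pi * |β.im|) *
    (2 ^ (β.re - 1) + 3 ^ (β.re - 1)) * Real.exp 1 * Real.Gamma β.re), ?_, fun t ht => ?_⟩
  · have := Real.Gamma_pos_of_pos hβ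
    positivity
  · have hne : (nhdsWithin (0 : ℝ) (Set.Ioc 0 1)).NeBot := by
      rw [nhdsWithin_Ioc_eq_nhdsGT zero_lt_one]
      infer_instance
    refine le_of_tendsto (tendsto_integral_poissonIntegrand hβ ht).norm ?_
    filter_upwards [self_mem_nhdsWithin] with ε hε
    rw [integral_poissonIntegrand_rect β t hε.1 hε.2, Real.rpow_neg (by linarith),
      ← Real.inv_rpow (by linarith), ← one_div]
    have h1 := norm_integral_poissonIntegrand_top_le hβ ht
    have h2 := norm_integral_poissonIntegrand_side_le hβ ht hε.1 hε.2 (s := 1) (by norm_num)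
    have h3 := norm_integral_poissonIntegrand_side_le hβ ht hε.1 hε.2 (s := -1) (by norm_num)
    refine (norm_add_le _ _).trans ((add_le_add_left (norm_sub_le _ _) _).trans ?_)
    rw [norm_mul, norm_mul, Complex.norm_I, one_mul, one_mul]
    refine (add_le_add (add_le_add h1 h2) h3).trans_eq ?_
    ring

/-- The function `u ↦ u_+^{α-1}`, with value `0` on `u ≤ 0` for every `α`. -/
noncomputable def posCpow (α : ℂ) (u : ℝ) : ℂ :=
  if 0 < u then (u : ℂ) ^ (α - 1) else 0

@[fun_prop]
lemma measurable_posCpow (α : ℂ) : Measurable (posCpow α) := by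
  unfold posCpow
  exact Measurable.ite measurableSet_Ioi (by fun_prop) measurable_const

lemma norm_posCpow_of_pos (α : ℂ) {u : ℝ} (hu : 0 < u) : ‖posCpow α u‖ = u ^ (α.re - 1) := by
  rw [posCpow, if_pos hu, Complex.norm_cpow_eq_rpow_re_of_pos hu, Complex.sub_re, Complex.one_re]

lemma posCpow_mul_of_pos (α : ℂ) {u : ℝ} (hu : 0 < u) (v : ℝ) :
    posCpow α (u * v) = (u : ℂ) ^ (α - 1) * posCpow α v := by
  by_cases hv : 0 < v
  · rw [posCpow, posCpow, if_pos (mul_pos hu hv), if_pos hv, Complex.ofReal_mul,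
      Complex.mul_cpow_ofReal_nonneg hu.le hv.le]
  · have : ¬ 0 < u * v := fun h => hv (pos_of_mul_pos_right h hu.le)
    rw [posCpow, posCpow, if_neg this, if_neg hv, mul_zero]

lemma integrable_posCpow_one_sub_norm_sq {α : ℂ} (hα : 0 < α.re) (n : ℕ) :
    Integrable (fun x : EuclideanSpace ℝ (Fin (n + 1)) => posCpow α (1 - ‖x‖ ^ 2)) := by
  rw [integrable_fun_norm_addHaar volume (f := fun r => posCpow α (1 - r ^ 2)),
    finrank_euclideanSpace_fin, Nat.add_sub_cancel]
  have hg : IntegrableOn (fun y : ℝ => (1 - y ^ 2) ^ (α.re - 1)) (Set.Ioo 0 1) :=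
    (((intervalIntegrable_iff_integrableOn_Ioc_of_le (by norm_num)).mp
      (intervalIntegrable_one_sub_sq_rpow (p := α.re - 1) (by linarith)))).mono_set
        fun y hy => ⟨by linarith [hy.1], hy.2.le⟩
  refine Integrable.mono' (hg.integrable_indicator measurableSet_Ioo).integrableOn
    (by fun_prop) ?_
  filter_upwards [ae_restrict_mem measurableSet_Ioi] with y hy
  have hy0 : (0 : ℝ) < y := hy
  by_cases hy1 : y < 1
  · rw [Set.indicator_of_mem (show y ∈ Set.Ioo 0 1 from ⟨hy0, hy1⟩), norm_smul, norm_posCpow_of_pos _ (by nlinarith), norm_pow,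
      Real.norm_of_nonneg hy0.le]
    exact mul_le_of_le_one_left (Real.rpow_nonneg (by nlinarith) _) (pow_le_one₀ hy0.le hy1.le)
  · have h0 : ¬ 0 < 1 - y ^ 2 := by nlinarith
    rw [posCpow, if_neg h0, smul_zero, norm_zero]
    exact Set.indicator_nonneg (fun z hz => Real.rpow_nonneg (by nlinarith [hz.1, hz.2]) _) _

lemma exists_orthonormalBasis_inner_eq {n : ℕ} (ξ : EuclideanSpace ℝ (Fin (n + 1))) :
    ∃ b : OrthonormalBasis (Fin (n + 1)) ℝ (EuclideanSpace ℝ (Fin (n + 1))),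
      ∀ x, ⟪x, ξ⟫ = ‖ξ‖ * b.repr x 0 := by
  rcases eq_or_ne ξ 0 with rfl | hξ
  · exact ⟨EuclideanSpace.basisFun _ ℝ, by simp⟩
  · have hn : ‖ξ‖ ≠ 0 := norm_ne_zero_iff.mpr hξ
    obtain ⟨b, hb⟩ := Orthonormal.exists_orthonormalBasis_extension_of_card_eq (𝕜 := ℝ)
      (E := EuclideanSpace ℝ (Fin (n + 1))) (ι := Fin (n + 1)) (by simp)
      (v := fun _ => ‖ξ‖⁻¹ • ξ) (s := {0}) (by
        constructor
        · intro i
          simp [norm_smul, hn]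
        · intro i j hij
          exact absurd (Subsingleton.elim i j) hij)
    refine ⟨b, fun x => ?_⟩
    rw [b.repr_apply_apply, hb 0 rfl, real_inner_smul_left, real_inner_comm, ← mul_assoc,
      mul_inv_cancel₀ hn, one_mul]

/-- Reduction of the Fourier integral of a radial function to an integral over hyperplanes. -/
lemma integral_radial_mul_exp_eq {n : ℕ} {g : ℝ → ℂ}
    (hg : Integrable (fun x : EuclideanSpace ℝ (Fin (n + 1)) => g (‖x‖ ^ 2)))
    (ξ : EuclideanSpace ℝ (Fin (n + 1))) :
    ∫ x : EuclideanSpace ℝ (Fin (n + 1)),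
        g (‖x‖ ^ 2) * Complex.exp (-(2 * Real.pi * ⟪x, ξ⟫) * Complex.I) =
      ∫ s : ℝ, (∫ y : Fin n → ℝ, g (s ^ 2 + ∑ i, y i ^ 2)) *
        Complex.exp (-(2 * Real.pi * (‖ξ‖ * s : ℝ)) * Complex.I) := by
  obtain ⟨b, hb⟩ := exists_orthonormalBasis_inner_eq ξ
  set F : EuclideanSpace ℝ (Fin (n + 1)) → ℂ := fun x =>
    g (‖x‖ ^ 2) * Complex.exp (-(2 * Real.pi * (‖ξ‖ * x 0 : ℝ)) * Complex.I) with hF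
  have hFi : Integrable F := by
    refine hg.mul_bdd (c := 1) (by fun_prop) (Filter.Eventually.of_forall fun x => ?_)
    rw [Complex.norm_exp]
    simp
  have h1 : ∫ x : EuclideanSpace ℝ (Fin (n + 1)),
      g (‖x‖ ^ 2) * Complex.exp (-(2 * Real.pi * ⟪x, ξ⟫) * Complex.I) = ∫ x, F x := by
    rw [← b.measurePreserving_repr.integral_comp b.repr.toHomeomorph.measurableEmbedding F]
    simp only [hF, hb, LinearIsometryEquiv.norm_map]
  let e := (MeasurableEquiv.piFinSuccAbove (fun _ : Fin (n + 1) => ℝ) 0).symm.trans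
    (MeasurableEquiv.toLp 2 (Fin (n + 1) → ℝ))
  have he : MeasurePreserving e (volume.prod volume) volume :=
    (PiLp.volume_preserving_toLp (Fin (n + 1))).comp
      (volume_preserving_piFinSuccAbove (fun _ : Fin (n + 1) => ℝ) 0).symm
  have hFe : ∀ (s : ℝ) (y : Fin n → ℝ), F (e (s, y)) = g (s ^ 2 + ∑ i, y i ^ 2) *
      Complex.exp (-(2 * Real.pi * (‖ξ‖ * s : ℝ)) * Complex.I) := by
    intro s y
    have h0 : e (s, y) 0 = s := rfl
    have hi : ∀ i : Fin n, e (s, y) i.succ = y i := fun i => rfl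
    simp only [hF, EuclideanSpace.real_norm_sq_eq, Fin.sum_univ_succ, h0, hi]
  rw [h1, ← he.integral_comp e.measurableEmbedding, integral_prod]
  · simp_rw [hFe, integral_mul_const]
  · exact (he.integrable_comp_emb e.measurableEmbedding).mpr hFi

lemma integral_posCpow_sub_sum_sq (α : ℂ) (n : ℕ) (u : ℝ) :
    ∫ y : Fin n → ℝ, posCpow α (u - ∑ i, y i ^ 2) =
      posCpow (α + n / 2) u * ∫ y : Fin n → ℝ, posCpow α (1 - ∑ i, y i ^ 2) := by
  by_cases hu : 0 < u
  · have hR : 0 < √u := Real.sqrt_pos.mpr hu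
    have h := Measure.integral_comp_smul (volume : Measure (Fin n → ℝ))
      (fun y => posCpow α (u - ∑ i, y i ^ 2)) √u
    have h2 : ∀ y : Fin n → ℝ, posCpow α (u - ∑ i, (√u • y) i ^ 2) =
        (u : ℂ) ^ (α - 1) * posCpow α (1 - ∑ i, y i ^ 2) := by
      intro y
      rw [← posCpow_mul_of_pos α hu]
      simp only [Pi.smul_apply, smul_eq_mul, mul_pow, Real.sq_sqrt hu.le, ← Finset.mul_sum]
      ring_nf
    simp_rw [h2] at h
    rw [integral_const_mul, Module.finrank_fin_fun, abs_of_pos (by positivity)] at h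
    have h3 : (u : ℂ) ^ (α + n / 2 - 1) = (√u ^ n : ℝ) * (u : ℂ) ^ (α - 1) := by
      rw [show α + n / 2 - 1 = ((n / 2 : ℝ) : ℂ) + (α - 1) by push_cast; ring,
        Complex.cpow_add _ _ (by exact_mod_cast hu.ne'), ← Complex.ofReal_cpow hu.le,
        Real.sqrt_eq_rpow, ← Real.rpow_mul_natCast hu.le]
      ring_nf
    rw [posCpow, if_pos hu, h3, mul_assoc, h, Complex.real_smul, ← mul_assoc, ← Complex.ofReal_mul,
      mul_inv_cancel₀ (by positivity), Complex.ofReal_one, one_mul]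
  · have h0 : ∀ y : Fin n → ℝ, ¬ 0 < u - ∑ i, y i ^ 2 := by
      intro y
      have := Finset.sum_nonneg fun i (_ : i ∈ Finset.univ) => sq_nonneg (y i)
      linarith
    simp [posCpow, h0, hu]

lemma integral_posCpow_mul_exp_eq (β : ℂ) (t : ℝ) :
    ∫ s : ℝ, posCpow β (1 - s ^ 2) * Complex.exp (-(t * s) * Complex.I) =
      ∫ s : ℝ in (-1)..1, poissonIntegrand β t s := by
  have h : ∀ s : ℝ, posCpow β (1 - s ^ 2) * Complex.exp (-(t * s) * Complex.I) =
      (Set.Ioo (-1) 1).indicator (fun s : ℝ => poissonIntegrand β t (-s : ℝ)) s := by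
    intro s
    by_cases hs : s ∈ Set.Ioo (-1 : ℝ) 1
    · rw [Set.indicator_of_mem hs, posCpow, if_pos (by nlinarith [hs.1, hs.2]), poissonIntegrand]
      push_cast
      ring_nf
    · have : ¬ 0 < 1 - s ^ 2 := fun h => hs (abs_lt.mp (by
        rw [← sq_lt_one_iff_abs_lt_one]; linarith))
      rw [Set.indicator_of_notMem hs, posCpow, if_neg this, zero_mul]
  simp_rw [h]
  rw [integral_indicator measurableSet_Ioo, ← integral_Ioc_eq_integral_Ioo,
    ← intervalIntegral.integral_of_le (by norm_num),
    intervalIntegral.integral_comp_neg (fun s : ℝ => poissonIntegrand β t s), neg_neg]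

/-- Fourier decay of `(1 - ‖x‖²)_+^{α-1}`, extended by zero outside of the open unit ball. -/
lemma exists_norm_integral_posCpow_mul_exp_le {α : ℂ} (hα : 0 < α.re) (n : ℕ) :
    ∃ C : ℝ, 0 < C ∧ ∀ ξ : EuclideanSpace ℝ (Fin (n + 1)),
      ‖∫ x, posCpow α (1 - ‖x‖ ^ 2) * Complex.exp (-(2 * Real.pi * ⟪x, ξ⟫) * Complex.I)‖
        ≤ C * (1 + ‖ξ‖) ^ (-((n : ℝ) / 2 + α.re)) := by
  have hre : (α + n / 2).re = n / 2 + α.re := by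
    rw [Complex.add_re, add_comm, show (n : ℂ) / 2 = ((n / 2 : ℝ) : ℂ) by push_cast; rfl,
      Complex.ofReal_re]
  have hβ : 0 < (α + n / 2).re := by
    rw [hre]
    positivity
  obtain ⟨C, hC, h⟩ := exists_norm_integral_poissonIntegrand_le hβ
  set c := ∫ y : Fin n → ℝ, posCpow α (1 - ∑ i, y i ^ 2)
  refine ⟨C * (‖c‖ + 1), by positivity, fun ξ => ?_⟩
  have hslice : ∀ s : ℝ, (∫ y : Fin n → ℝ, posCpow α (1 - (s ^ 2 + ∑ i, y i ^ 2))) *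
      Complex.exp (-(2 * Real.pi * (‖ξ‖ * s : ℝ)) * Complex.I) =
      c * (posCpow (α + n / 2) (1 - s ^ 2) *
        Complex.exp (-((2 * Real.pi * ‖ξ‖ : ℝ) * s) * Complex.I)) := by
    intro s
    simp_rw [← sub_sub]
    rw [integral_posCpow_sub_sum_sq, mul_comm _ c, mul_assoc]
    push_cast
    simp only [mul_assoc]
  rw [integral_radial_mul_exp_eq (g := fun r => posCpow α (1 - r))
    (integrable_posCpow_one_sub_norm_sq hα n)]
  simp_rw [hslice]
  rw [integral_const_mul, integral_posCpow_mul_exp_eq, norm_mul, ← hre]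
  have hle : (1 + 2 * Real.pi * ‖ξ‖) ^ (-(α + n / 2).re) ≤ (1 + ‖ξ‖) ^ (-(α + n / 2).re) := by
    refine Real.rpow_le_rpow_of_nonpos (by positivity) ?_ (by linarith)
    nlinarith [Real.pi_gt_three, norm_nonneg ξ]
  calc _ ≤ (‖c‖ + 1) * (C * (1 + ‖ξ‖) ^ (-(α + n / 2).re)) := by
        gcongr
        · linarith
        · exact (h _ (by positivity)).trans (by gcongr)
    _ = _ := by ring

/-- Let `d ≥ 2` and `α ∈ ℂ` with `Re α > 0`. Then the Fourier transform
of `σ^α` satisfies `|\widehat{σ^α}(ξ)| ≤ C (1 + |ξ|)^{-(d-1)/2 - Re α}`. -/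
theorem sigmaAlpha_fourier_decay
    (d : ℕ) (hd : 2 ≤ d) (α : ℂ) (hα : 0 < α.re) :
    ∃ C : ℝ, 0 < C ∧ ∀ ξ : EuclideanSpace ℝ (Fin d),
      ‖∫ x, sigmaAlpha d α x * Complex.exp (-(2 * Real.pi * ⟪x, ξ⟫) * Complex.I) ∂volume‖
        ≤ C * (1 + ‖ξ‖) ^ (-(((d : ℝ) - 1) / 2 + α.re)) := by
  obtain ⟨n, rfl⟩ : ∃ n, d = n + 1 := ⟨d - 1, by omega⟩
  obtain ⟨C, hC, h⟩ := exists_norm_integral_posCpow_mul_exp_le hα n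
  refine ⟨C * (‖1 / Complex.Gamma α‖ + 1), by positivity, fun ξ => ?_⟩
  by_cases h1 : α = 1
  · -- Here `0 ^ 0 = 1` makes `sigmaAlpha` the constant `1`, and the integral has its default value.
    have hni : ¬ Integrable (fun x : EuclideanSpace ℝ (Fin (n + 1)) =>
        sigmaAlpha (n + 1) α x * Complex.exp (-(2 * Real.pi * ⟪x, ξ⟫) * Complex.I)) := by
      intro hi
      have hn := hi.norm
      have hone : (fun x : EuclideanSpace ℝ (Fin (n + 1)) => ‖sigmaAlpha (n + 1) α x *
          Complex.exp (-(2 * Real.pi * ⟪x, ξ⟫) * Complex.I)‖) = fun _ => 1 := by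
        ext x
        rw [norm_mul, Complex.norm_exp]
        simp [sigmaAlpha, h1]
      rw [hone, integrable_const_iff] at hn
      rcases hn with hn | hn
      · exact one_ne_zero hn
      · exact (measure_ne_top (volume : Measure (EuclideanSpace ℝ (Fin (n + 1)))) Set.univ)
          (measure_univ_of_isAddLeftInvariant _)
    rw [integral_undef hni, norm_zero]
    positivity
  · have hs : ∀ x : EuclideanSpace ℝ (Fin (n + 1)), sigmaAlpha (n + 1) α x =
        1 / Complex.Gamma α * posCpow α (1 - ‖x‖ ^ 2) := by
      intro x
      rw [sigmaAlpha, posCpow]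
      split_ifs with hx
      · rw [max_eq_left hx.le]
      · rw [max_eq_right (not_lt.mp hx), Complex.ofReal_zero,
          Complex.zero_cpow (sub_ne_zero.mpr h1)]
    simp_rw [hs, mul_assoc]
    rw [integral_const_mul, norm_mul]
    have he : -((((n + 1 : ℕ) : ℝ) - 1) / 2 + α.re) = -((n : ℝ) / 2 + α.re) := by
      push_cast
      ring
    rw [he, mul_left_comm]
    gcongr
    · linarith
    · simpa only [mul_assoc] using h ξ
end

section
/- Let d ≥ 2, t > 0, and let μ be a compactly supported Borel probability measure on ℝ^d with μ(B(x,r)) ≤ C r^s for all x and r > 0, where s > (d+1)/2. For ε ∈ (0,1) define f_1 = σ_t^ε * μ and, recursively, f_k = σ_t^ε * (f_{k−1} μ) for k ≥ 2. Then for every k ≥ 1 there is a constant C(k), independent of ε ∈ (0,1), such that ‖f_k‖_{L²(μ)} ≤ C(k). -/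
open MeasureTheory Set Metric
open scoped ENNReal RealInnerProductSpace

/-- The surface measure `σ_t` on the sphere of radius `t` in `ℝ^d`, realized as the
`(d-1)`-dimensional Hausdorff measure restricted to the sphere. -/
noncomputable def sphereMeasure (d : ℕ) (t : ℝ) : Measure (EuclideanSpace ℝ (Fin d)) :=
  (MeasureTheory.Measure.hausdorffMeasure ((d : ℝ) - 1)).restrict
    (Metric.sphere (0 : EuclideanSpace ℝ (Fin d)) t)

/-- The mollified surface measure `σ_t^ε = σ_t * ρ_ε`, where `ρ_ε(x) = ε^{-d} ρ(x/ε)`. -/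
noncomputable def mollifiedSphere (d : ℕ) (t ε : ℝ) (ρ : EuclideanSpace ℝ (Fin d) → ℝ)
    (x : EuclideanSpace ℝ (Fin d)) : ℝ :=
  ∫ y, (ε ^ d)⁻¹ * ρ (ε⁻¹ • (x - y)) ∂(sphereMeasure d t)

/-- The recursively defined functions `f_1 = g * μ` and `f_{k+1} = g * (f_k μ)`, where `g * ν`
denotes convolution of a function with a measure; here `chainFn μ g k` is `f_{k+1}`. -/
noncomputable def chainFn {d : ℕ} (μ : Measure (EuclideanSpace ℝ (Fin d)))
    (g : EuclideanSpace ℝ (Fin d) → ℝ) : ℕ → EuclideanSpace ℝ (Fin d) → ℝ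
  | 0 => fun x => ∫ y, g (x - y) ∂μ
  | k + 1 => fun x => ∫ y, g (x - y) * chainFn μ g k y ∂μ

section SphereMeasure

/-- Radial projection to the sphere is Lipschitz away from the open unit ball. -/
theorem lipschitzOnWith_normalize {E : Type*} [NormedAddCommGroup E] [NormedSpace ℝ E] :
    LipschitzOnWith 2 (fun x : E => ‖x‖⁻¹ • x) {x | 1 ≤ ‖x‖} := by
  refine LipschitzOnWith.of_dist_le_mul fun x hx y hy => ?_
  have hx' : 0 < ‖x‖ := lt_of_lt_of_le one_pos hx
  have hy' : 0 < ‖y‖ := lt_of_lt_of_le one_pos hy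
  rw [dist_eq_norm, dist_eq_norm]
  have key : ‖x‖⁻¹ • x - ‖y‖⁻¹ • y = ‖x‖⁻¹ • (x - y) + (‖x‖⁻¹ - ‖y‖⁻¹) • y := by
    rw [smul_sub, sub_smul]; abel
  have h1 : ‖x‖⁻¹ ≤ 1 := inv_le_one_of_one_le₀ hx
  have h2 : ‖(‖x‖⁻¹ - ‖y‖⁻¹) • y‖ ≤ ‖x‖⁻¹ * ‖x - y‖ := by
    have : (‖x‖⁻¹ - ‖y‖⁻¹) * ‖y‖ = ‖x‖⁻¹ * (‖y‖ - ‖x‖) := by field_simp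
    rw [norm_smul, Real.norm_eq_abs, ← abs_of_pos hy', ← abs_mul, abs_of_pos hy', this, abs_mul,
      abs_of_pos (inv_pos.2 hx')]
    gcongr
    rw [abs_sub_comm]
    exact abs_norm_sub_norm_le x y
  calc ‖‖x‖⁻¹ • x - ‖y‖⁻¹ • y‖ ≤ ‖‖x‖⁻¹ • (x - y)‖ + ‖(‖x‖⁻¹ - ‖y‖⁻¹) • y‖ := by
        rw [key]; exact norm_add_le _ _
    _ ≤ ‖x‖⁻¹ * ‖x - y‖ + ‖x‖⁻¹ * ‖x - y‖ := by
        gcongr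
        rw [norm_smul, norm_inv, norm_norm]
    _ ≤ 1 * ‖x - y‖ + 1 * ‖x - y‖ := by gcongr
    _ = (2 : NNReal) * ‖x - y‖ := by push_cast; ring

theorem hausdorffMeasure_sphere_lt_top (n : ℕ) {t : ℝ} (ht : 0 < t) :
    (Measure.hausdorffMeasure (n : ℝ) : Measure (EuclideanSpace ℝ (Fin (n + 1))))
      (sphere 0 t) < ∞ := by
  let G : Fin (n + 1) → ℝ → (Fin n → ℝ) → EuclideanSpace ℝ (Fin (n + 1)) :=
    fun i s y => WithLp.toLp 2 (Fin.insertNth (α := fun _ => ℝ) i s y)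
  let N : EuclideanSpace ℝ (Fin (n + 1)) → EuclideanSpace ℝ (Fin (n + 1)) :=
    fun x => ‖x‖⁻¹ • x
  let Q : Set (Fin n → ℝ) := Icc (-1) 1
  have hG : ∀ i s, ∃ K, LipschitzWith K (G i s) := fun i s => by
    refine ⟨_, (PiLp.lipschitzWith_toLp 2 (fun _ : Fin (n + 1) => ℝ)).comp
      (LipschitzWith.of_dist_le_mul (K := 1) fun x y => ?_)⟩
    rw [NNReal.coe_one, one_mul, dist_pi_le_iff dist_nonneg]
    intro j
    induction j using Fin.succAboveCases i with
    | x => simp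
    | p j => simpa using dist_le_pi_dist x y j
  have hG1 : ∀ i s, |s| = 1 → ∀ y, 1 ≤ ‖G i s y‖ := fun i s hs y => by
    have := PiLp.norm_apply_le (G i s y) i
    simpa [G, hs] using this
  have hfin : ∀ i s, |s| = 1 → (Measure.hausdorffMeasure (n : ℝ)) ((fun y => t • N (G i s y)) '' Q) < ∞ := by
    intro i s hs
    obtain ⟨K, hK⟩ := hG i s
    have h1 : LipschitzOnWith (2 * K) (N ∘ G i s) Q :=
      lipschitzOnWith_normalize.comp hK.lipschitzOnWith (fun y _ => hG1 i s hs y)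
    have h2 := (lipschitzWith_smul t (β := EuclideanSpace ℝ (Fin (n + 1)))).comp_lipschitzOnWith h1
    refine (h2.hausdorffMeasure_image_le (Nat.cast_nonneg n)).trans_lt ?_
    refine ENNReal.mul_lt_top (ENNReal.rpow_lt_top_of_nonneg (Nat.cast_nonneg n) ENNReal.coe_ne_top) ?_
    have := hausdorffMeasure_pi_real (ι := Fin n)
    rw [Fintype.card_fin] at this
    rw [this]
    exact isCompact_Icc.measure_lt_top
  have hcover : sphere (0 : EuclideanSpace ℝ (Fin (n + 1))) t ⊆
      ⋃ i : Fin (n + 1), ((fun y => t • N (G i 1 y)) '' Q ∪ (fun y => t • N (G i (-1) y)) '' Q) := by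
    intro x hx
    rw [mem_sphere_zero_iff_norm] at hx
    obtain ⟨i, hi⟩ := Finite.exists_max (fun i => |x i|)
    have hxi : 0 < |x i| := by
      by_contra h
      have : x = 0 := by
        ext j
        have := (hi j).trans (not_lt.1 h)
        simpa using this
      rw [this, norm_zero] at hx
      exact ht.ne hx
    have key : ∀ s : ℝ, x i = s * |x i| →
        t • N (G i s (fun j => x (i.succAbove j) / |x i|)) = x := by
      intro s hs
      have : G i s (fun j => x (i.succAbove j) / |x i|) = |x i|⁻¹ • x := by
        ext j
        induction j using Fin.succAboveCases i with
        | x =>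
          simp only [G, Fin.insertNth_apply_same, PiLp.smul_apply, smul_eq_mul]
          rw [eq_inv_mul_iff_mul_eq₀ hxi.ne']; linarith
        | p j => simp [G, div_eq_inv_mul]
      rw [this]
      simp only [N, norm_smul, hx, norm_inv, Real.norm_eq_abs, abs_abs, smul_smul]
      rw [show t * ((|x i|⁻¹ * t)⁻¹ * |x i|⁻¹) = 1 by field_simp, one_smul]
    have hQ : (fun j => x (i.succAbove j) / |x i|) ∈ Q := by
      rw [mem_Icc, Pi.le_def, Pi.le_def, ← forall_and]
      intro j
      refine abs_le.1 (?_ : |x (i.succAbove j) / (|x i|)| ≤ 1)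
      rw [abs_div, abs_abs, div_le_one hxi]
      exact hi _
    refine mem_iUnion.2 ⟨i, ?_⟩
    rcases abs_choice (x i) with h | h
    · exact Or.inl ⟨_, hQ, key 1 (by linarith)⟩
    · exact Or.inr ⟨_, hQ, key (-1) (by linarith)⟩
  refine (measure_mono hcover).trans_lt ((measure_iUnion_le _).trans_lt ?_)
  rw [tsum_fintype, ENNReal.sum_lt_top]
  intro i _
  exact (measure_union_le _ _).trans_lt
    (ENNReal.add_lt_top.2 ⟨hfin i 1 (by simp), hfin i (-1) (by simp)⟩)

theorem isFiniteMeasure_sphereMeasure {d : ℕ} (hd : 2 ≤ d) {t : ℝ} (ht : 0 < t) :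
    IsFiniteMeasure (sphereMeasure d t) := by
  obtain ⟨n, rfl⟩ : ∃ n, d = n + 1 := ⟨d - 1, by omega⟩
  refine ⟨?_⟩
  have := hausdorffMeasure_sphere_lt_top n ht
  simpa [sphereMeasure] using this

theorem sphereMeasure_ae_norm_eq (d : ℕ) (t : ℝ) : ∀ᵐ x ∂sphereMeasure d t, ‖x‖ = t := by
  filter_upwards [ae_restrict_mem isClosed_sphere.measurableSet] with x hx
  simpa using hx

theorem map_sphereMeasure (d : ℕ) (t : ℝ)
    (R : EuclideanSpace ℝ (Fin d) ≃ₗᵢ[ℝ] EuclideanSpace ℝ (Fin d)) :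
    (sphereMeasure d t).map R = sphereMeasure d t := by
  have h := (R.toIsometryEquiv.measurePreserving_hausdorffMeasure ((d : ℝ) - 1)).restrict_preimage
    (s := sphere 0 t) isClosed_sphere.measurableSet
  have h2 : R.toIsometryEquiv ⁻¹' sphere 0 t = sphere 0 t := by
    ext x; simp
  rw [h2] at h
  exact h.map_eq

end SphereMeasure

section Decay

open InnerProductSpace

variable {E : Type*} [NormedAddCommGroup E] [InnerProductSpace ℝ E] [MeasurableSpace E]
  [BorelSpace E]

/-- The infinitesimal form of invariance of `σ` under rotations in the plane of `e` and `f`. -/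
theorem integral_inner_mul_sin_eq (σ : Measure E) [IsFiniteMeasure σ]
    (hinv : ∀ R : E ≃ₗᵢ[ℝ] E, σ.map R = σ) {t : ℝ} (hσ : ∀ᵐ x ∂σ, ‖x‖ = t)
    {e f : E} (he : ‖e‖ = 1) (hf : ‖f‖ = 1) (hef : ⟪e, f⟫ = 0) (r : ℝ) :
    r * ∫ x, ⟪f, x⟫ ^ 2 * Real.cos (r * ⟪e, x⟫) ∂σ = ∫ x, ⟪e, x⟫ * Real.sin (r * ⟪e, x⟫) ∂σ := by
  let a : ℝ → E → ℝ := fun φ x =>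
    2 * (Real.cos φ * ⟪e, x⟫ + Real.sin φ * ⟪f, x⟫) * Real.cos φ - ⟪e, x⟫
  let b : ℝ → E → ℝ := fun φ x =>
    2 * (Real.cos φ * ⟪e, x⟫ + Real.sin φ * ⟪f, x⟫) * Real.sin φ - ⟪f, x⟫
  let a' : ℝ → E → ℝ := fun φ x =>
    2 * (-Real.sin φ * ⟪e, x⟫ + Real.cos φ * ⟪f, x⟫) * Real.cos φ
      + 2 * (Real.cos φ * ⟪e, x⟫ + Real.sin φ * ⟪f, x⟫) * (-Real.sin φ)
  let b' : ℝ → E → ℝ := fun φ x =>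
    2 * (-Real.sin φ * ⟪e, x⟫ + Real.cos φ * ⟪f, x⟫) * Real.sin φ
      + 2 * (Real.cos φ * ⟪e, x⟫ + Real.sin φ * ⟪f, x⟫) * Real.cos φ
  let F : ℝ → E → ℝ := fun φ x => b φ x * Real.sin (r * a φ x)
  let F' : ℝ → E → ℝ := fun φ x =>
    b' φ x * Real.sin (r * a φ x) + b φ x * (Real.cos (r * a φ x) * (r * a' φ x))
  have hconst : ∀ φ, ∫ x, F φ x ∂σ = ∫ x, ⟪f, x⟫ * Real.sin (r * ⟪e, x⟫) ∂σ := by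
    intro φ
    set u : E := Real.cos φ • e + Real.sin φ • f with hu
    have hee : ⟪e, e⟫ = 1 := by rw [real_inner_self_eq_norm_sq, he]; norm_num
    have hff : ⟪f, f⟫ = 1 := by rw [real_inner_self_eq_norm_sq, hf]; norm_num
    have hfe : ⟪f, e⟫ = 0 := by rw [real_inner_comm]; exact hef
    have hun : ‖u‖ ^ 2 = 1 := by
      rw [← real_inner_self_eq_norm_sq, hu]
      simp only [inner_add_left, inner_add_right, inner_smul_left, inner_smul_right, hee, hff, hef,
        hfe, RCLike.conj_to_real]
      linarith [Real.sin_sq_add_cos_sq φ]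
    let R : E ≃ₗᵢ[ℝ] E := (ℝ ∙ u).reflection
    have hR : ∀ x, R x = (2 * ⟪u, x⟫) • u - x := fun x => by
      have h := Submodule.reflection_singleton_apply (𝕜 := ℝ) u x
      rw [show R x = (ℝ ∙ u).reflection x from rfl, h]
      simp [hun, two_smul, add_smul, two_mul]
    conv_rhs => rw [← hinv R]
    rw [integral_map R.continuous.measurable.aemeasurable]
    · refine integral_congr_ae (Filter.Eventually.of_forall fun x => ?_)
      have h1 : ⟪e, R x⟫ = a φ x := by
        rw [hR, hu]
        simp only [inner_sub_right, inner_smul_right, inner_add_right, inner_add_left,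
          inner_smul_left, hee, hef, RCLike.conj_to_real, a]
        ring
      have h2 : ⟪f, R x⟫ = b φ x := by
        rw [hR, hu]
        simp only [inner_sub_right, inner_smul_right, inner_add_right, inner_add_left,
          inner_smul_left, hff, hfe, RCLike.conj_to_real, b]
        ring
      simp only [F, h1, h2]
    · exact (by fun_prop : Continuous fun x => ⟪f, x⟫ * Real.sin (r * ⟪e, x⟫)).aestronglyMeasurable
  have hcont : ∀ φ, Continuous (F φ) := fun φ => by simp only [F, a, b]; fun_prop
  have hcont' : ∀ φ, Continuous (F' φ) := fun φ => by simp only [F', a, b, a', b']; fun_prop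
  have hip : ∀ (g x : E), ‖g‖ = 1 → ‖x‖ = t → |⟪g, x⟫| ≤ t := fun g x hg hx => by
    have := abs_real_inner_le_norm g x
    rwa [hg, hx, one_mul] at this
  have hcs : ∀ φ p q : ℝ, |p| ≤ t → |q| ≤ t → |Real.cos φ * p + Real.sin φ * q| ≤ 2 * t ∧
      |-Real.sin φ * p + Real.cos φ * q| ≤ 2 * t := fun φ p q hp hq => by
    have hm : ∀ c p : ℝ, |c| ≤ 1 → |p| ≤ t → |c * p| ≤ t := fun c p hc hp => by
      rw [abs_mul]; nlinarith [abs_nonneg c, abs_nonneg p]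
    have h1 := hm _ _ (Real.abs_cos_le_one φ) hp
    have h2 := hm _ _ (Real.abs_sin_le_one φ) hq
    have h3 := hm (-Real.sin φ) _ (by rw [abs_neg]; exact Real.abs_sin_le_one φ) hp
    have h4 := hm _ _ (Real.abs_cos_le_one φ) hq
    exact ⟨(abs_add_le _ _).trans (by linarith), (abs_add_le _ _).trans (by linarith)⟩
  have habs : ∀ p c T : ℝ, |p| ≤ T → |c| ≤ 1 → |p * c| ≤ T := fun p c T hp hc => by
    rw [abs_mul]; nlinarith [abs_nonneg c, abs_nonneg p]
  have hbd : ∀ φ x, ‖x‖ = t → ‖F φ x‖ ≤ 5 * t ∧ ‖F' φ x‖ ≤ 8 * t + 5 * t * (|r| * (8 * t)) := by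
    intro φ x hx
    obtain ⟨h1, h2⟩ := hcs φ ⟪e, x⟫ ⟪f, x⟫ (hip e x he hx) (hip f x hf hx)
    have h1' : |2 * (Real.cos φ * ⟪e, x⟫ + Real.sin φ * ⟪f, x⟫)| ≤ 4 * t := by
      rw [abs_mul, abs_two]; linarith
    have h2' : |2 * (-Real.sin φ * ⟪e, x⟫ + Real.cos φ * ⟪f, x⟫)| ≤ 4 * t := by
      rw [abs_mul, abs_two]; linarith
    have hb : |b φ x| ≤ 5 * t := (abs_sub _ _).trans
      (by linarith [habs _ _ _ h1' (Real.abs_sin_le_one φ), hip f x hf hx])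
    have ha' : |a' φ x| ≤ 8 * t := (abs_add_le _ _).trans
      (by linarith [habs _ _ _ h2' (Real.abs_cos_le_one φ),
            habs _ (-Real.sin φ) _ h1' (by rw [abs_neg]; exact Real.abs_sin_le_one φ)])
    have hb' : |b' φ x| ≤ 8 * t := (abs_add_le _ _).trans
      (by linarith [habs _ _ _ h2' (Real.abs_sin_le_one φ),
            habs _ _ _ h1' (Real.abs_cos_le_one φ)])
    have hra : |Real.cos (r * a φ x) * (r * a' φ x)| ≤ |r| * (8 * t) := by
      rw [mul_comm]
      refine habs _ _ _ ?_ (Real.abs_cos_le_one _)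
      rw [abs_mul]
      gcongr
    refine ⟨habs _ _ _ hb (Real.abs_sin_le_one _), (abs_add_le _ _).trans ?_⟩
    refine add_le_add (habs _ _ _ hb' (Real.abs_sin_le_one _)) ?_
    rw [abs_mul]
    exact mul_le_mul hb hra (abs_nonneg _) ((abs_nonneg _).trans hb)
  have hderiv := hasDerivAt_integral_of_dominated_loc_of_deriv_le (μ := σ) (F := F) (F' := F')
    (x₀ := (0 : ℝ)) (s := univ) (bound := fun _ => 8 * t + 5 * t * (|r| * (8 * t)))
    Filter.univ_mem
    (Filter.Eventually.of_forall fun φ => (hcont φ).aestronglyMeasurable)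
    (Integrable.of_bound (hcont 0).aestronglyMeasurable (5 * t) (hσ.mono fun x hx => (hbd 0 x hx).1))
    (hcont' 0).aestronglyMeasurable
    (hσ.mono fun x hx φ _ => (hbd φ x hx).2) (integrable_const _)
    (Filter.Eventually.of_forall fun x φ _ => by
      have hc := Real.hasDerivAt_cos φ
      have hs := Real.hasDerivAt_sin φ
      have hcs := ((hc.mul_const ⟪e, x⟫).add (hs.mul_const ⟪f, x⟫)).const_mul 2
      have ha : HasDerivAt (fun φ => a φ x) (a' φ x) φ := (hcs.mul hc).sub_const ⟪e, x⟫
      have hb : HasDerivAt (fun φ => b φ x) (b' φ x) φ := (hcs.mul hs).sub_const ⟪f, x⟫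
      exact hb.mul ((ha.const_mul r).sin))
  have hzero : ∫ x, F' 0 x ∂σ = 0 := by
    refine hderiv.2.unique ?_
    simp only [hconst]
    exact hasDerivAt_const _ _
  have hF'0 : ∀ x, F' 0 x = 2 * (⟪e, x⟫ * Real.sin (r * ⟪e, x⟫))
      - 2 * r * (⟪f, x⟫ ^ 2 * Real.cos (r * ⟪e, x⟫)) := fun x => by
    simp only [F', a, b, a', b', Real.sin_zero, Real.cos_zero]
    ring_nf
  have hint : ∀ g : E → ℝ, Continuous g → ∀ T, (∀ x, ‖x‖ = t → |g x| ≤ T) → Integrable g σ :=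
    fun g hg T hT => Integrable.of_bound hg.aestronglyMeasurable T (hσ.mono hT)
  have hi1 : Integrable (fun x => ⟪e, x⟫ * Real.sin (r * ⟪e, x⟫)) σ :=
    hint _ (by fun_prop) t fun x hx => habs _ _ _ (hip e x he hx) (Real.abs_sin_le_one _)
  have hi2 : Integrable (fun x => ⟪f, x⟫ ^ 2 * Real.cos (r * ⟪e, x⟫)) σ :=
    hint _ (by fun_prop) (t ^ 2) fun x hx => habs _ _ _
      (by rw [abs_pow]; exact pow_le_pow_left₀ (abs_nonneg _) (hip f x hf hx) 2)
      (Real.abs_cos_le_one _)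
  simp only [hF'0] at hzero
  rw [integral_sub (hi1.const_mul 2) (hi2.const_mul (2 * r)), integral_const_mul,
    integral_const_mul] at hzero
  linarith

theorem hasDerivAt_integral_cos (σ : Measure E) [IsFiniteMeasure σ] {t : ℝ}
    (hσ : ∀ᵐ x ∂σ, ‖x‖ = t) {e : E} (he : ‖e‖ = 1) (r : ℝ) :
    HasDerivAt (fun r => ∫ x, Real.cos (r * ⟪e, x⟫) ∂σ)
        (∫ x, -(⟪e, x⟫ * Real.sin (r * ⟪e, x⟫)) ∂σ) r ∧
      HasDerivAt (fun r => ∫ x, -(⟪e, x⟫ * Real.sin (r * ⟪e, x⟫)) ∂σ)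
        (∫ x, -(⟪e, x⟫ ^ 2 * Real.cos (r * ⟪e, x⟫)) ∂σ) r := by
  have hip : ∀ x, ‖x‖ = t → |⟪e, x⟫| ≤ t := fun x hx => by
    have := abs_real_inner_le_norm e x
    rwa [he, hx, one_mul] at this
  have habs : ∀ p c T : ℝ, |p| ≤ T → |c| ≤ 1 → |p * c| ≤ T := fun p c T hp hc => by
    rw [abs_mul]; nlinarith [abs_nonneg c, abs_nonneg p]
  have hb1 : ∀ r x, ‖x‖ = t → ‖-(⟪e, x⟫ * Real.sin (r * ⟪e, x⟫))‖ ≤ t := fun r x hx => by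
    rw [norm_neg]; exact habs _ _ _ (hip x hx) (Real.abs_sin_le_one _)
  have hb2 : ∀ r x, ‖x‖ = t → ‖-(⟪e, x⟫ ^ 2 * Real.cos (r * ⟪e, x⟫))‖ ≤ t ^ 2 := fun r x hx => by
    rw [norm_neg]
    exact habs _ _ _ (by rw [abs_pow]; exact pow_le_pow_left₀ (abs_nonneg _) (hip x hx) 2)
      (Real.abs_cos_le_one _)
  constructor
  · refine (hasDerivAt_integral_of_dominated_loc_of_deriv_le (s := univ) (bound := fun _ => t)
      (F := fun r x => Real.cos (r * ⟪e, x⟫))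
      (F' := fun r x => -(⟪e, x⟫ * Real.sin (r * ⟪e, x⟫))) Filter.univ_mem
      (Filter.Eventually.of_forall fun r => (by fun_prop : Continuous _).aestronglyMeasurable)
      (Integrable.of_bound (by fun_prop : Continuous _).aestronglyMeasurable 1
        (Filter.Eventually.of_forall fun x => Real.abs_cos_le_one _))
      (by fun_prop : Continuous _).aestronglyMeasurable
      (hσ.mono fun x hx r _ => hb1 r x hx) (integrable_const _)
      (Filter.Eventually.of_forall fun x r _ => ?_)).2
    exact ((hasDerivAt_id' r).mul_const ⟪e, x⟫).cos.congr_deriv (by ring)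
  · refine (hasDerivAt_integral_of_dominated_loc_of_deriv_le (s := univ) (bound := fun _ => t ^ 2)
      (F := fun r x => -(⟪e, x⟫ * Real.sin (r * ⟪e, x⟫)))
      (F' := fun r x => -(⟪e, x⟫ ^ 2 * Real.cos (r * ⟪e, x⟫))) Filter.univ_mem
      (Filter.Eventually.of_forall fun r => (by fun_prop : Continuous _).aestronglyMeasurable)
      (Integrable.of_bound (by fun_prop : Continuous _).aestronglyMeasurable t
        (hσ.mono fun x hx => hb1 r x hx))
      (by fun_prop : Continuous _).aestronglyMeasurable
      (hσ.mono fun x hx r _ => hb2 r x hx) (integrable_const _)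
      (Filter.Eventually.of_forall fun x r _ => ?_)).2
    exact ((((hasDerivAt_id' r).mul_const ⟪e, x⟫).sin).const_mul ⟪e, x⟫).neg.congr_deriv (by ring)

/-- Solutions of the Bessel-type equation `P'' + (n / r) P' + t² P = 0` are `O(r ^ (-n / 2))`. -/
theorem exists_pow_mul_sq_le_of_bessel {P Q : ℝ → ℝ} {n : ℕ} {t : ℝ} (ht : 0 < t)
    (hP : ∀ r, 0 < r → HasDerivAt P (Q r) r)
    (hQ : ∀ r, 0 < r → HasDerivAt Q (-(n / r * Q r) - t ^ 2 * P r) r) :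
    ∃ C, ∀ r, 1 ≤ r → r ^ n * P r ^ 2 ≤ C := by
  let A : ℝ → ℝ := fun r => Q r + n / 2 * (r⁻¹ * P r)
  let W : ℝ → ℝ := fun r => A r ^ 2 + t ^ 2 * P r ^ 2
  let κ : ℝ := |(n : ℝ) ^ 2 / 4 - n / 2| / t
  let H : ℝ → ℝ := fun r => r ^ n * W r * Real.exp (κ * r⁻¹)
  have hκ : 0 ≤ κ := by positivity
  have hd : ∀ r, 0 < r → HasDerivAt H
      (r ^ n * (2 * (A r * P r) * ((n : ℝ) ^ 2 / 4 - n / 2) - κ * W r) / r ^ 2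
        * Real.exp (κ * r⁻¹)) r := by
    intro r hr
    have hinv : HasDerivAt (fun r : ℝ => r⁻¹) (-(1 / r ^ 2)) r := by
      simpa using hasDerivAt_inv hr.ne'
    have hA : HasDerivAt A (-(n / r * Q r) - t ^ 2 * P r
        + n / 2 * (-(1 / r ^ 2) * P r + 1 / r * Q r)) r := by
      rw [one_div r]
      exact (hQ r hr).add ((hinv.mul (hP r hr)).const_mul ((n : ℝ) / 2))
    have hW : HasDerivAt W (2 * A r * (-(n / r * Q r) - t ^ 2 * P r
        + n / 2 * (-(1 / r ^ 2) * P r + 1 / r * Q r)) + t ^ 2 * (2 * P r * Q r)) r := by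
      refine ((hA.pow 2).add (((hP r hr).pow 2).const_mul (t ^ 2))).congr_deriv ?_
      simp
    have hH := ((hasDerivAt_pow n r).mul hW).mul ((hinv.const_mul κ).exp)
    refine hH.congr_deriv ?_
    have hpow : (n : ℝ) * r ^ (n - 1) = n * r ^ n / r := by
      rcases n with _ | m
      · simp
      · field_simp; simp [pow_succ]
    rw [hpow]
    simp only [W, A, Pi.mul_apply]
    field_simp
    ring
  have hanti : AntitoneOn H (Ici 1) := by
    refine antitoneOn_of_deriv_nonpos (convex_Ici 1) ?_ ?_ ?_
    · exact fun r hr => (hd r (one_pos.trans_le hr)).continuousAt.continuousWithinAt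
    · intro r hr
      rw [interior_Ici] at hr
      exact (hd r (one_pos.trans hr)).differentiableAt.differentiableWithinAt
    · intro r hr
      rw [interior_Ici] at hr
      have hr0 : 0 < r := one_pos.trans hr
      rw [(hd r hr0).deriv]
      refine mul_nonpos_of_nonpos_of_nonneg (div_nonpos_of_nonpos_of_nonneg
        (mul_nonpos_of_nonneg_of_nonpos (by positivity) ?_) (by positivity)) (Real.exp_pos _).le
      have h1 : |2 * (A r * P r)| ≤ W r / t := by
        rw [le_div_iff₀ ht, show |2 * (A r * P r)| * t = |2 * (A r * P r) * t| by
          rw [abs_mul _ t, abs_of_pos ht], abs_le]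
        constructor
        · nlinarith [sq_nonneg (A r + t * P r)]
        · nlinarith [sq_nonneg (A r - t * P r)]
      have h2 : 2 * (A r * P r) * ((n : ℝ) ^ 2 / 4 - n / 2) ≤ W r / t * |(n : ℝ) ^ 2 / 4 - n / 2| :=
        (le_abs_self _).trans (by rw [abs_mul]; gcongr)
      have h3 : κ * W r = W r / t * |(n : ℝ) ^ 2 / 4 - n / 2| := by simp only [κ]; ring
      linarith
  refine ⟨H 1 / t ^ 2, fun r hr => ?_⟩
  have hr0 : 0 < r := one_pos.trans_le hr
  rw [le_div_iff₀ (by positivity)]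
  refine le_trans ?_ (hanti self_mem_Ici hr hr)
  have h1 : 1 ≤ Real.exp (κ * r⁻¹) := Real.one_le_exp (by positivity)
  have h2 : 0 ≤ r ^ n * W r := by positivity
  calc r ^ n * P r ^ 2 * t ^ 2 ≤ r ^ n * W r := by
        rw [mul_assoc]
        gcongr
        simp only [W]
        nlinarith [sq_nonneg (A r)]
    _ ≤ H r := by simp only [H]; nlinarith

theorem exists_pow_mul_integral_cos_sq_le (σ : Measure E) [IsFiniteMeasure σ]
    (hinv : ∀ R : E ≃ₗᵢ[ℝ] E, σ.map R = σ) {t : ℝ} (ht : 0 < t) (hσ : ∀ᵐ x ∂σ, ‖x‖ = t)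
    {n : ℕ} (b : OrthonormalBasis (Fin (n + 1)) ℝ E) :
    ∃ C, ∀ r, 1 ≤ r → r ^ n * (∫ x, Real.cos (r * ⟪b 0, x⟫) ∂σ) ^ 2 ≤ C := by
  have he : ∀ i, ‖b i‖ = 1 := b.orthonormal.1
  refine exists_pow_mul_sq_le_of_bessel ht (fun r _ => (hasDerivAt_integral_cos σ hσ (he 0) r).1)
    (fun r hr => (hasDerivAt_integral_cos σ hσ (he 0) r).2.congr_deriv ?_)
  have hint : ∀ i, Integrable (fun x => ⟪b i, x⟫ ^ 2 * Real.cos (r * ⟪b 0, x⟫)) σ := fun i =>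
    Integrable.of_bound (by fun_prop : Continuous _).aestronglyMeasurable (t ^ 2)
      (hσ.mono fun x hx => by
        have h1 : |⟪b i, x⟫| ≤ t := by
          have := abs_real_inner_le_norm (b i) x
          rwa [he, hx, one_mul] at this
        rw [norm_mul, norm_pow]
        have h2 := Real.abs_cos_le_one (r * ⟪b 0, x⟫)
        calc ‖⟪b i, x⟫‖ ^ 2 * ‖Real.cos (r * ⟪b 0, x⟫)‖ ≤ t ^ 2 * 1 := by
              gcongr
              · exact h1
              · exact h2
          _ = t ^ 2 := mul_one _)
  have hsum : ∑ i, ∫ x, ⟪b i, x⟫ ^ 2 * Real.cos (r * ⟪b 0, x⟫) ∂σ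
      = t ^ 2 * ∫ x, Real.cos (r * ⟪b 0, x⟫) ∂σ := by
    rw [← integral_finsetSum _ fun i _ => hint i, ← integral_const_mul]
    refine integral_congr_ae (hσ.mono fun x hx => ?_)
    simp only
    rw [← Finset.sum_mul, b.sum_sq_inner_right, hx]
  have hrest : ∀ i : Fin n, ∫ x, ⟪b i.succ, x⟫ ^ 2 * Real.cos (r * ⟪b 0, x⟫) ∂σ
      = r⁻¹ * ∫ x, ⟪b 0, x⟫ * Real.sin (r * ⟪b 0, x⟫) ∂σ := fun i => by
    rw [← integral_inner_mul_sin_eq σ hinv hσ (he 0) (he i.succ)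
      (b.orthonormal.2 (Fin.succ_ne_zero i).symm) r, inv_mul_cancel_left₀ hr.ne']
  rw [Fin.sum_univ_succ] at hsum
  simp only [hrest, Finset.sum_const, Finset.card_univ, Fintype.card_fin, nsmul_eq_mul] at hsum
  rw [integral_neg, integral_neg, ← hsum]
  ring

/-- Fourier decay of a rotation invariant measure on a sphere. -/
theorem exists_norm_integral_cexp_le (σ : Measure E) [IsFiniteMeasure σ]
    (hinv : ∀ R : E ≃ₗᵢ[ℝ] E, σ.map R = σ) {t : ℝ} (ht : 0 < t) (hσ : ∀ᵐ x ∂σ, ‖x‖ = t)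
    {n : ℕ} (b : OrthonormalBasis (Fin (n + 1)) ℝ E) :
    ∃ C, ∀ ξ : E, 1 ≤ ‖ξ‖ →
      ‖ξ‖ ^ n * ‖∫ x, Complex.exp ((2 * Real.pi * ⟪ξ, x⟫ : ℝ) * Complex.I) ∂σ‖ ^ 2 ≤ C := by
  obtain ⟨C, hC⟩ := exists_pow_mul_integral_cos_sq_le σ hinv ht hσ b
  refine ⟨C, fun ξ hξ => ?_⟩
  have hcos : ∫ x, Real.cos (2 * Real.pi * ⟪ξ, x⟫) ∂σ
      = ∫ x, Real.cos (2 * Real.pi * ‖ξ‖ * ⟪b 0, x⟫) ∂σ := by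
    let R : E ≃ₗᵢ[ℝ] E := (ℝ ∙ (ξ - ‖ξ‖ • b 0))ᗮ.reflection
    have hR : R ξ = ‖ξ‖ • b 0 := Submodule.reflection_sub (by
      rw [norm_smul, b.orthonormal.1 0, norm_norm, mul_one])
    conv_rhs => rw [← hinv R]
    rw [integral_map R.continuous.measurable.aemeasurable
      (by fun_prop : Continuous _).aestronglyMeasurable]
    refine integral_congr_ae (Filter.Eventually.of_forall fun x => ?_)
    simp only
    rw [← R.inner_map_map ξ x, hR, inner_smul_left, RCLike.conj_to_real]
    ring_nf
  have hsin : ∫ x, Real.sin (2 * Real.pi * ⟪ξ, x⟫) ∂σ = 0 := by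
    have : ∫ x, Real.sin (2 * Real.pi * ⟪ξ, x⟫) ∂σ
        = -∫ x, Real.sin (2 * Real.pi * ⟪ξ, x⟫) ∂σ := by
      conv_lhs => rw [← hinv (LinearIsometryEquiv.neg ℝ)]
      rw [integral_map (LinearIsometryEquiv.neg ℝ).continuous.measurable.aemeasurable
        (by fun_prop : Continuous _).aestronglyMeasurable, ← integral_neg]
      simp
    linarith
  have hexp : ∫ x, Complex.exp ((2 * Real.pi * ⟪ξ, x⟫ : ℝ) * Complex.I) ∂σ
      = ((∫ x, Real.cos (2 * Real.pi * ‖ξ‖ * ⟪b 0, x⟫) ∂σ : ℝ) : ℂ) := by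
    rw [← hcos, ← integral_complex_ofReal]
    have h0 : ∫ x, ((Real.sin (2 * Real.pi * ⟪ξ, x⟫) : ℝ) : ℂ) * Complex.I ∂σ = 0 := by
      rw [integral_mul_const, integral_complex_ofReal, hsin]; simp
    rw [← add_zero (∫ x, ((Real.cos (2 * Real.pi * ⟪ξ, x⟫) : ℝ) : ℂ) ∂σ), ← h0, ← integral_add]
    · refine integral_congr_ae (Filter.Eventually.of_forall fun x => ?_)
      simp only
      rw [Complex.exp_mul_I, Complex.ofReal_cos, Complex.ofReal_sin]
    · refine Integrable.of_bound (by fun_prop : Continuous _).aestronglyMeasurable 1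
        (Filter.Eventually.of_forall fun x => ?_)
      rw [Complex.norm_real]; exact Real.abs_cos_le_one _
    · refine Integrable.of_bound (by fun_prop : Continuous _).aestronglyMeasurable 1
        (Filter.Eventually.of_forall fun x => ?_)
      rw [norm_mul, Complex.norm_I, mul_one, Complex.norm_real]; exact Real.abs_sin_le_one _
  have hpi : 1 ≤ 2 * Real.pi := by linarith [Real.pi_gt_three]
  rw [hexp, Complex.norm_real, Real.norm_eq_abs, sq_abs]
  refine le_trans ?_ (hC (2 * Real.pi * ‖ξ‖) (by nlinarith))
  gcongr
  nlinarith [norm_nonneg ξ]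

end Decay

section GaussianWeight

variable {V : Type*} [NormedAddCommGroup V]

theorem summable_exp_neg_mul_add_one_rpow (s : ℝ) :
    Summable fun k : ℕ => Real.exp (-(k : ℝ)) * ((k : ℝ) + 1) ^ s := by
  have h := (summable_nat_add_iff 1).2 (Real.summable_pow_mul_exp_neg_nat_mul ⌈s⌉₊ one_pos)
  refine Summable.of_nonneg_of_le (fun k => by positivity) (fun k => ?_) (h.mul_left (Real.exp 1))
  have h1 : ((k : ℝ) + 1) ^ s ≤ ((k : ℝ) + 1) ^ ⌈s⌉₊ := by
    rw [← Real.rpow_natCast]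
    exact Real.rpow_le_rpow_of_exponent_le (by linarith [Nat.cast_nonneg (α := ℝ) k]) (Nat.le_ceil s)
  have h2 : Real.exp 1 * Real.exp (-1 * ((k + 1 : ℕ) : ℝ)) = Real.exp (-(k : ℝ)) := by
    rw [← Real.exp_add]; congr 1; push_cast; ring
  calc _ ≤ Real.exp (-(k : ℝ)) * ((k : ℝ) + 1) ^ ⌈s⌉₊ := by gcongr
    _ = _ := by rw [← h2]; push_cast; ring

/-- Gaussian averages of a measure satisfying a Frostman-type ball condition. -/
theorem integral_exp_neg_norm_sub_sq_le [MeasurableSpace V] [BorelSpace V] {μ : Measure V} {C s : ℝ} (hC : 0 < C)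
    (hball : ∀ (x : V) (r : ℝ), 0 < r → μ (closedBall x r) ≤ ENNReal.ofReal (C * r ^ s))
    {R : ℝ} (hR : 0 < R) (x : V) :
    ∫ y, Real.exp (-Real.pi * R ^ 2 * ‖x - y‖ ^ 2) ∂μ
      ≤ C * (∑' k : ℕ, Real.exp (-(k : ℝ)) * ((k : ℝ) + 1) ^ s) * R ^ (-s) := by
  have hsum := summable_exp_neg_mul_add_one_rpow s
  have hpt : ∀ y, ENNReal.ofReal (Real.exp (-Real.pi * R ^ 2 * ‖x - y‖ ^ 2))
      ≤ ∑' k : ℕ, (closedBall x (((k : ℝ) + 1) / R)).indicator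
        (fun _ => ENNReal.ofReal (Real.exp (-(k : ℝ)))) y := by
    intro y
    set u := R * ‖x - y‖ with hu
    have hu0 : 0 ≤ u := by positivity
    set k := ⌊u⌋₊ with hk
    have hmem : y ∈ closedBall x (((k : ℝ) + 1) / R) := by
      rw [mem_closedBall, dist_comm, dist_eq_norm, le_div_iff₀ hR, mul_comm]
      exact (Nat.lt_floor_add_one u).le
    refine le_trans ?_ (ENNReal.le_tsum k)
    rw [indicator_of_mem hmem]
    refine ENNReal.ofReal_le_ofReal (Real.exp_le_exp.2 ?_)
    have hku : (k : ℝ) ≤ u := Nat.floor_le hu0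
    have hkk : (k : ℝ) ≤ (k : ℝ) ^ 2 := by exact_mod_cast Nat.le_self_pow two_ne_zero k
    have : -Real.pi * R ^ 2 * ‖x - y‖ ^ 2 = -(Real.pi * u ^ 2) := by rw [hu]; ring
    rw [this]
    nlinarith [Real.pi_gt_three, pow_le_pow_left₀ (Nat.cast_nonneg k) hku 2, sq_nonneg u]
  have hterm : ∀ k : ℕ, ∫⁻ y, (closedBall x (((k : ℝ) + 1) / R)).indicator
        (fun _ => ENNReal.ofReal (Real.exp (-(k : ℝ)))) y ∂μ
      ≤ ENNReal.ofReal (C * R ^ (-s) * (Real.exp (-(k : ℝ)) * ((k : ℝ) + 1) ^ s)) := by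
    intro k
    rw [lintegral_indicator_const isClosed_closedBall.measurableSet]
    refine (mul_le_mul_right (hball x _ (by positivity)) _).trans ?_
    rw [← ENNReal.ofReal_mul (Real.exp_pos _).le]
    refine ENNReal.ofReal_le_ofReal (le_of_eq ?_)
    rw [Real.div_rpow (by positivity) hR.le, Real.rpow_neg hR.le]
    ring
  rw [integral_eq_lintegral_of_nonneg_ae (Filter.Eventually.of_forall fun y => (Real.exp_pos _).le)
    (by fun_prop : Continuous _).aestronglyMeasurable]
  refine ENNReal.toReal_le_of_le_ofReal ?_ ?_
  · have : 0 ≤ ∑' k : ℕ, Real.exp (-(k : ℝ)) * ((k : ℝ) + 1) ^ s :=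
      tsum_nonneg fun k => by positivity
    positivity
  calc _ ≤ ∫⁻ y, ∑' k : ℕ, (closedBall x (((k : ℝ) + 1) / R)).indicator
        (fun _ => ENNReal.ofReal (Real.exp (-(k : ℝ)))) y ∂μ := lintegral_mono hpt
    _ = ∑' k : ℕ, ∫⁻ y, (closedBall x (((k : ℝ) + 1) / R)).indicator
        (fun _ => ENNReal.ofReal (Real.exp (-(k : ℝ)))) y ∂μ :=
        lintegral_tsum fun k =>
          (measurable_const.indicator isClosed_closedBall.measurableSet).aemeasurable
    _ ≤ ∑' k : ℕ, ENNReal.ofReal (C * R ^ (-s) * (Real.exp (-(k : ℝ)) * ((k : ℝ) + 1) ^ s)) :=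
        ENNReal.tsum_le_tsum hterm
    _ = ENNReal.ofReal (∑' k : ℕ, C * R ^ (-s) * (Real.exp (-(k : ℝ)) * ((k : ℝ) + 1) ^ s)) :=
        (ENNReal.ofReal_tsum_of_nonneg (fun k => by positivity) (hsum.mul_left _)).symm
    _ = _ := by rw [tsum_mul_left]; congr 1; ring

/-- The dyadic superposition of Gaussians dominating the decay of a multiplier. -/
noncomputable def gaussianWeight (q : ℝ) (ξ : V) : ℝ :=
  ∑' j : ℕ, q ^ j * Real.exp (-Real.pi * ‖ξ‖ ^ 2 / (2 ^ j) ^ 2)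

theorem summable_gaussianWeight {q : ℝ} (hq : 0 ≤ q) (hq1 : q < 1) (ξ : V) :
    Summable fun j : ℕ => q ^ j * Real.exp (-Real.pi * ‖ξ‖ ^ 2 / (2 ^ j) ^ 2) := by
  refine Summable.of_nonneg_of_le (fun j => by positivity) (fun j => ?_)
    (summable_geometric_of_lt_one hq hq1)
  refine mul_le_of_le_one_right (by positivity) (Real.exp_le_one_iff.2 ?_)
  rw [neg_mul, neg_div]
  exact neg_nonpos.2 (by positivity)

/-- Power decay at infinity is dominated by a `gaussianWeight`. -/
theorem le_gaussianWeight_of_decay {n : ℕ} {q : ℝ} (hq : 0 ≤ q) (hq1 : q < 1)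
    (hqn : q ^ 2 * 2 ^ n = 1) {f : V → ℝ} {S D : ℝ}
    (hfS : ∀ ξ, f ξ ≤ S) (hS : 0 ≤ S) (hfD : ∀ ξ, 1 ≤ ‖ξ‖ → ‖ξ‖ ^ n * f ξ ^ 2 ≤ D) (ξ : V) :
    f ξ ≤ Real.exp (4 * Real.pi) * (S + √D) * gaussianWeight q ξ := by
  have hsum := summable_gaussianWeight hq hq1 ξ
  have hle : ∀ j : ℕ, q ^ j * Real.exp (-Real.pi * ‖ξ‖ ^ 2 / (2 ^ j) ^ 2) ≤ gaussianWeight q ξ :=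
    fun j => hsum.le_tsum j fun i _ => by positivity
  suffices ∃ j : ℕ, ‖ξ‖ ≤ 2 * 2 ^ j ∧ f ξ ≤ (S + √D) * q ^ j by
    obtain ⟨j, hj, hf⟩ := this
    have h1 : Real.exp (-(4 * Real.pi)) ≤ Real.exp (-Real.pi * ‖ξ‖ ^ 2 / (2 ^ j) ^ 2) := by
      refine Real.exp_le_exp.2 ?_
      rw [le_div_iff₀ (by positivity)]
      nlinarith [pow_le_pow_left₀ (norm_nonneg ξ) hj 2, Real.pi_pos]
    calc f ξ ≤ (S + √D) * q ^ j := hf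
      _ = Real.exp (4 * Real.pi) * (S + √D) * (q ^ j * Real.exp (-(4 * Real.pi))) := by
        rw [Real.exp_neg]; field_simp
      _ ≤ Real.exp (4 * Real.pi) * (S + √D) *
          (q ^ j * Real.exp (-Real.pi * ‖ξ‖ ^ 2 / (2 ^ j) ^ 2)) := by gcongr
      _ ≤ _ := by gcongr; exact hle j
  rcases le_total ‖ξ‖ 1 with h | h
  · refine ⟨0, by linarith [pow_zero (2 : ℝ)], ?_⟩
    rw [pow_zero, mul_one]
    linarith [hfS ξ, Real.sqrt_nonneg D]
  · obtain ⟨j, hj1, hj2⟩ := exists_nat_pow_near h one_lt_two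
    refine ⟨j, by rw [← pow_succ']; exact hj2.le, ?_⟩
    have hqj : (q ^ j) ^ 2 * (2 ^ j) ^ n = 1 := by
      rw [← pow_mul, ← pow_mul, mul_comm j 2, mul_comm j n, pow_mul, pow_mul, ← mul_pow, hqn,
        one_pow]
    have h1 : f ξ ^ 2 ≤ D * (q ^ j) ^ 2 := by
      calc f ξ ^ 2 = (q ^ j) ^ 2 * ((2 ^ j) ^ n * f ξ ^ 2) := by rw [← mul_assoc, hqj, one_mul]
        _ ≤ (q ^ j) ^ 2 * (‖ξ‖ ^ n * f ξ ^ 2) := by gcongr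
        _ ≤ (q ^ j) ^ 2 * D := by gcongr; exact hfD ξ h
        _ = _ := mul_comm _ _
    have h2 := (le_abs_self _).trans (Real.abs_le_sqrt h1)
    rw [Real.sqrt_mul' _ (sq_nonneg _), Real.sqrt_sq (by positivity)] at h2
    have : 0 ≤ S * q ^ j := by positivity
    linarith

end GaussianWeight

section Energy

open Complex (I)
open scoped ComplexConjugate

variable {V : Type*} [NormedAddCommGroup V] [InnerProductSpace ℝ V]

/-- The plane wave `x ↦ exp (2πi ⟪ξ, x⟫)`. -/
noncomputable def planeWave (ξ x : V) : ℂ := Complex.exp ((2 * Real.pi * ⟪ξ, x⟫ : ℝ) * I)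

theorem norm_planeWave (ξ x : V) : ‖planeWave ξ x‖ = 1 := Complex.norm_exp_ofReal_mul_I _

theorem continuous_planeWave : Continuous fun p : V × V => planeWave p.1 p.2 := by
  unfold planeWave; fun_prop

@[fun_prop]
theorem Continuous.planeWave {X : Type*} [TopologicalSpace X] {f g : X → V} (hf : Continuous f)
    (hg : Continuous g) : Continuous fun x => _root_.planeWave (f x) (g x) :=
  continuous_planeWave.comp (hf.prodMk hg)

theorem planeWave_sub (ξ x y : V) :
    planeWave ξ (x - y) = planeWave ξ x * conj (planeWave ξ y) := by
  unfold planeWave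
  rw [← Complex.exp_conj, ← Complex.exp_add, inner_sub_right]
  congr 1
  simp only [map_mul, Complex.conj_ofReal, Complex.conj_I]
  push_cast
  ring

variable [MeasurableSpace V]

/-- The Fourier transform of the measure `g μ`, up to the sign of the frequency. -/
noncomputable def densityTransform (μ : Measure V) (g : V → ℝ) (ξ : V) : ℂ :=
  ∫ x, (g x : ℂ) * planeWave ξ x ∂μ

variable {μ : Measure V} [IsFiniteMeasure μ]

theorem norm_densityTransform_le {g : V → ℝ} {B : ℝ} (hB : ∀ x, |g x| ≤ B) (ξ : V) :
    ‖densityTransform μ g ξ‖ ≤ B * μ.real univ :=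
  norm_integral_le_of_norm_le_const (Filter.Eventually.of_forall fun x => by
    rw [norm_mul, norm_planeWave, mul_one, Complex.norm_real]; exact hB x)

variable [BorelSpace V]

theorem integrable_ofReal_mul_planeWave {g : V → ℝ} (hg : Measurable g) {B : ℝ}
    (hB : ∀ x, |g x| ≤ B) (ξ : V) : Integrable (fun x => (g x : ℂ) * planeWave ξ x) μ := by
  refine Integrable.of_bound (Measurable.aestronglyMeasurable ?_) B
    (Filter.Eventually.of_forall fun x => ?_)
  · exact (Complex.measurable_ofReal.comp hg).mul (by fun_prop : Continuous _).measurable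
  · rw [norm_mul, norm_planeWave, mul_one, Complex.norm_real]; exact hB x

theorem continuous_densityTransform {g : V → ℝ} (hg : Measurable g) {B : ℝ}
    (hB : ∀ x, |g x| ≤ B) : Continuous (densityTransform μ g) := by
  refine continuous_of_dominated
    (fun ξ => (integrable_ofReal_mul_planeWave hg hB ξ).aestronglyMeasurable)
    (fun ξ => Filter.Eventually.of_forall fun x => ?_) (integrable_const B)
    (Filter.Eventually.of_forall fun x => by fun_prop)
  rw [norm_mul, norm_planeWave, mul_one, Complex.norm_real]; exact hB x

variable [FiniteDimensional ℝ V]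

/-- A bilinear form with convolution kernel is a multiplier form on the Fourier side. -/
theorem integral_kernel_eq_integral_multiplier {m : V → ℂ} (hm : Integrable m) {K : V → ℂ}
    (hK : ∀ z, K z = ∫ ξ, m ξ * planeWave ξ z) {g h : V → ℝ} (hg : Measurable g)
    (hh : Measurable h) {B : ℝ} (hgB : ∀ x, |g x| ≤ B) (hhB : ∀ x, |h x| ≤ B) :
    ∫ p : V × V, K (p.1 - p.2) * (h p.1 * g p.2 : ℝ) ∂(μ.prod μ)
      = ∫ ξ, m ξ * (densityTransform μ h ξ * conj (densityTransform μ g ξ)) := by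
  have hint : Integrable (fun q : (V × V) × V =>
      m q.2 * planeWave q.2 (q.1.1 - q.1.2) * (h q.1.1 * g q.1.2 : ℝ)) ((μ.prod μ).prod volume) := by
    have h1 : Integrable (fun q : (V × V) × V => m q.2) ((μ.prod μ).prod volume) :=
      hm.comp_snd _
    have h2 := h1.mul_bdd (c := B * B) (g := fun q : (V × V) × V => planeWave q.2 (q.1.1 - q.1.2)
      * ((h q.1.1 * g q.1.2 : ℝ) : ℂ)) ?_ (Filter.Eventually.of_forall fun q => ?_)
    · simpa only [mul_assoc] using h2
    · refine Measurable.aestronglyMeasurable (Measurable.mul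
        (by fun_prop : Continuous _).measurable (Complex.measurable_ofReal.comp ?_))
      fun_prop
    · rw [norm_mul, norm_planeWave, one_mul, Complex.norm_real, norm_mul]
      exact mul_le_mul (hhB _) (hgB _) (abs_nonneg _) ((abs_nonneg _).trans (hhB q.1.1))
  have hL : ∀ p : V × V, K (p.1 - p.2) * (h p.1 * g p.2 : ℝ)
      = ∫ ξ, m ξ * planeWave ξ (p.1 - p.2) * (h p.1 * g p.2 : ℝ) := fun p => by
    rw [hK, integral_mul_const]
  simp only [hL]
  rw [integral_integral_swap hint]
  refine integral_congr_ae (Filter.Eventually.of_forall fun ξ => ?_)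
  simp only
  rw [densityTransform, densityTransform, ← integral_conj, ← integral_prod_mul, ← integral_const_mul]
  refine integral_congr_ae (Filter.Eventually.of_forall fun p => ?_)
  simp only [planeWave_sub, map_mul, Complex.conj_ofReal]
  push_cast
  ring

theorem integral_gaussian_planeWave {R : ℝ} (hR : 0 < R) (z : V) :
    ((R ^ Module.finrank ℝ V * Real.exp (-Real.pi * R ^ 2 * ‖z‖ ^ 2) : ℝ) : ℂ)
      = ∫ ξ : V, ((Real.exp (-Real.pi * ‖ξ‖ ^ 2 / R ^ 2) : ℝ) : ℂ) * planeWave ξ z := by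
  have hb : 0 < ((Real.pi / R ^ 2 : ℝ) : ℂ).re := by
    rw [Complex.ofReal_re]; positivity
  have key := GaussianFourier.integral_cexp_neg_mul_sq_norm_add hb (2 * Real.pi * I) z
  have hRc : (R : ℂ) ≠ 0 := by exact_mod_cast hR.ne'
  have hpi : (Real.pi : ℂ) ≠ 0 := by exact_mod_cast Real.pi_ne_zero
  trans ∫ v : V, Complex.exp (-((Real.pi / R ^ 2 : ℝ) : ℂ) * ‖v‖ ^ 2 + 2 * Real.pi * I * ⟪z, v⟫)
  · rw [key]
    push_cast
    congr 1
    · rw [show (Real.pi : ℂ) / (Real.pi / R ^ 2) = ((R ^ 2 : ℝ) : ℂ) by push_cast; field_simp,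
        show (Module.finrank ℝ V / 2 : ℂ) = ((Module.finrank ℝ V / 2 : ℝ) : ℂ) by push_cast; rfl,
        ← Complex.ofReal_cpow (by positivity), ← Real.rpow_natCast R 2, ← Real.rpow_mul hR.le,
        show ((2 : ℕ) : ℝ) * (Module.finrank ℝ V / 2 : ℝ) = Module.finrank ℝ V by push_cast; ring,
        Real.rpow_natCast]
      push_cast; rfl
    · congr 1
      field_simp
      rw [Complex.I_sq]
      ring
  · refine integral_congr_ae (Filter.Eventually.of_forall fun ξ => ?_)
    simp only [planeWave]
    rw [Complex.ofReal_exp, ← Complex.exp_add, real_inner_comm]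
    congr 1
    push_cast
    ring

theorem integrable_gaussian {R : ℝ} (hR : 0 < R) :
    Integrable fun ξ : V => Real.exp (-Real.pi * ‖ξ‖ ^ 2 / R ^ 2) := by
  have hb : 0 < ((Real.pi / R ^ 2 : ℝ) : ℂ).re := by
    rw [Complex.ofReal_re]; positivity
  have := (GaussianFourier.integrable_cexp_neg_mul_sq_norm_add hb 0 (0 : V)).norm
  refine this.congr (Filter.Eventually.of_forall fun ξ => ?_)
  simp only [zero_mul, add_zero]
  rw [Complex.norm_exp]
  congr 1
  have : -((Real.pi / R ^ 2 : ℝ) : ℂ) * (‖ξ‖ : ℂ) ^ 2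
    = ((-Real.pi * ‖ξ‖ ^ 2 / R ^ 2 : ℝ) : ℂ) := by push_cast; ring
  rw [this, Complex.ofReal_re]

theorem integral_gaussian_mul_norm_sq_le {R : ℝ} (hR : 0 < R) {S : ℝ}
    (hS : ∀ x, ∫ y, Real.exp (-Real.pi * R ^ 2 * ‖x - y‖ ^ 2) ∂μ ≤ S)
    {g : V → ℝ} (hg : Measurable g) {B : ℝ} (hB : ∀ x, |g x| ≤ B) :
    ∫ ξ, Real.exp (-Real.pi * ‖ξ‖ ^ 2 / R ^ 2) * ‖densityTransform μ g ξ‖ ^ 2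
      ≤ R ^ Module.finrank ℝ V * S * ∫ x, g x ^ 2 ∂μ := by
  let G : V × V → ℝ := fun p => Real.exp (-Real.pi * R ^ 2 * ‖p.1 - p.2‖ ^ 2)
  have hG0 : ∀ p, 0 ≤ G p := fun p => (Real.exp_pos _).le
  have hG1 : ∀ p, G p ≤ 1 := fun p => by
    refine Real.exp_le_one_iff.2 ?_
    have : 0 ≤ Real.pi * R ^ 2 * ‖p.1 - p.2‖ ^ 2 := by positivity
    linarith
  have hGm : Measurable G := (by fun_prop : Continuous G).measurable
  have hB0 : 0 ≤ B := (abs_nonneg _).trans (hB 0)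
  have key := integral_kernel_eq_integral_multiplier (μ := μ) (integrable_gaussian (V := V) hR).ofReal
    (integral_gaussian_planeWave hR) hg hg hB hB
  have key' : ∫ ξ, Real.exp (-Real.pi * ‖ξ‖ ^ 2 / R ^ 2) * ‖densityTransform μ g ξ‖ ^ 2
      = R ^ Module.finrank ℝ V * ∫ p, G p * (g p.1 * g p.2) ∂(μ.prod μ) := by
    rw [← integral_const_mul]
    apply Complex.ofReal_injective
    rw [← integral_complex_ofReal, ← integral_complex_ofReal]
    refine Eq.trans ?_ (key.symm.trans ?_)
    · refine integral_congr_ae (Filter.Eventually.of_forall fun ξ => ?_)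
      simp only [Complex.mul_conj, Complex.normSq_eq_norm_sq, Complex.ofReal_mul]
      rfl
    · refine integral_congr_ae (Filter.Eventually.of_forall fun p => ?_)
      simp only [G]
      push_cast
      ring
  rw [key', mul_assoc]
  refine mul_le_mul_of_nonneg_left ?_ (by positivity)
  have hsq : ∀ x, g x ^ 2 ≤ B ^ 2 := fun x => by
    rw [← sq_abs]; exact pow_le_pow_left₀ (abs_nonneg _) (hB x) 2
  have hb : ∀ {f : V × V → ℝ}, Measurable f → (∀ p, |f p| ≤ B ^ 2) →
      Integrable (fun p => G p * f p) (μ.prod μ) := fun {f} hf hfb =>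
    Integrable.of_bound (hGm.mul hf).aestronglyMeasurable (B ^ 2)
      (Filter.Eventually.of_forall fun p => by
        rw [norm_mul, Real.norm_of_nonneg (hG0 p)]
        nlinarith [hG1 p, hG0 p, hfb p, norm_nonneg (f p), Real.norm_eq_abs (f p)])
  have h1 : Integrable (fun p : V × V => G p * g p.1 ^ 2) (μ.prod μ) :=
    hb (by fun_prop) fun p => by rw [abs_of_nonneg (sq_nonneg _)]; exact hsq _
  have h2 : Integrable (fun p : V × V => G p * g p.2 ^ 2) (μ.prod μ) :=
    hb (by fun_prop) fun p => by rw [abs_of_nonneg (sq_nonneg _)]; exact hsq _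
  have h3 : Integrable (fun p : V × V => G p * (g p.1 * g p.2)) (μ.prod μ) :=
    hb (by fun_prop) fun p => by
      rw [abs_mul, sq]; exact mul_le_mul (hB _) (hB _) (abs_nonneg _) hB0
  have hgi : Integrable (fun x => g x ^ 2) μ :=
    Integrable.of_bound (hg.pow_const 2).aestronglyMeasurable (B ^ 2)
      (Filter.Eventually.of_forall fun x => by
        rw [Real.norm_of_nonneg (sq_nonneg _)]; exact hsq x)
  have hswap : ∫ p, G p * g p.2 ^ 2 ∂(μ.prod μ) = ∫ p, G p * g p.1 ^ 2 ∂(μ.prod μ) := by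
    rw [← integral_prod_swap]
    refine integral_congr_ae (Filter.Eventually.of_forall fun p => ?_)
    simp only [G, Prod.fst_swap, Prod.snd_swap, norm_sub_rev p.2 p.1]
  have hdiag : ∫ p, G p * g p.1 ^ 2 ∂(μ.prod μ) ≤ S * ∫ x, g x ^ 2 ∂μ := by
    rw [integral_prod _ h1, ← integral_const_mul]
    refine integral_mono h1.integral_prod_left (hgi.const_mul S) fun x => ?_
    simp only [G]
    rw [integral_mul_const]
    exact mul_le_mul_of_nonneg_right (hS x) (sq_nonneg _)
  calc ∫ p, G p * (g p.1 * g p.2) ∂(μ.prod μ)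
      ≤ ∫ p, (1 / 2 * (G p * g p.1 ^ 2) + 1 / 2 * (G p * g p.2 ^ 2)) ∂(μ.prod μ) := by
        refine integral_mono h3 ((h1.const_mul _).add (h2.const_mul _)) fun p => ?_
        simp only
        nlinarith [mul_nonneg (hG0 p) (sq_nonneg (g p.1 - g p.2))]
    _ = ∫ p, G p * g p.1 ^ 2 ∂(μ.prod μ) := by
        rw [integral_add (h1.const_mul _) (h2.const_mul _), integral_const_mul, integral_const_mul,
          hswap]
        ring
    _ ≤ _ := hdiag

/-- Multipliers dominated by `gaussianWeight q` give bounded bilinear forms on `L²(μ)`. -/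
theorem exists_norm_integral_multiplier_le {C s : ℝ} (hC : 0 < C)
    (hball : ∀ (x : V) (r : ℝ), 0 < r → μ (closedBall x r) ≤ ENNReal.ofReal (C * r ^ s))
    {q : ℝ} (hq : 0 ≤ q) (hq1 : q < 1) (hqs : q * 2 ^ (Module.finrank ℝ V : ℝ) * 2 ^ (-s) < 1)
    {M : ℝ} (hM : 0 ≤ M) :
    ∃ A, 0 < A ∧ ∀ m : V → ℂ, (∀ ξ, ‖m ξ‖ ≤ M * gaussianWeight q ξ) →
      ∀ g h : V → ℝ, Measurable g → Measurable h → ∀ B, (∀ x, |g x| ≤ B) → (∀ x, |h x| ≤ B) →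
        ‖∫ ξ, m ξ * (densityTransform μ h ξ * conj (densityTransform μ g ξ))‖
          ≤ A * (∫ x, g x ^ 2 ∂μ + ∫ x, h x ^ 2 ∂μ) := by
  set T : ℝ := ∑' k : ℕ, Real.exp (-(k : ℝ)) * ((k : ℝ) + 1) ^ s with hT
  have hT0 : 0 ≤ T := tsum_nonneg fun k => by positivity
  set q' : ℝ := q * 2 ^ (Module.finrank ℝ V : ℝ) * 2 ^ (-s) with hq'
  have hq'0 : 0 ≤ q' := by positivity
  set A : ℝ := M * (C * T) * (1 - q')⁻¹ with hA
  have hA0 : 0 ≤ A := mul_nonneg (by positivity) (inv_nonneg.2 (by linarith))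
  refine ⟨A + 1, by positivity, fun m hm g h hg hh B hgB hhB => ?_⟩
  have hNg : 0 ≤ ∫ x, g x ^ 2 ∂μ := integral_nonneg fun x => sq_nonneg _
  have hNh : 0 ≤ ∫ x, h x ^ 2 ∂μ := integral_nonneg fun x => sq_nonneg _
  set N : ℝ := ∫ x, g x ^ 2 ∂μ + ∫ x, h x ^ 2 ∂μ with hN
  let G : ℕ → V → ℝ := fun j ξ => Real.exp (-Real.pi * ‖ξ‖ ^ 2 / (2 ^ j) ^ 2)
  let F : ℕ → V → ℝ := fun j ξ => M * q ^ j *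
    (G j ξ * ‖densityTransform μ g ξ‖ ^ 2 + G j ξ * ‖densityTransform μ h ξ‖ ^ 2)
  have hF0 : ∀ j ξ, 0 ≤ F j ξ := fun j ξ => by positivity
  have hF : ∀ ξ, (fun j => F j ξ) = fun j => (q ^ j * Real.exp (-Real.pi * ‖ξ‖ ^ 2 / (2 ^ j) ^ 2)) *
      (M * (‖densityTransform μ g ξ‖ ^ 2 + ‖densityTransform μ h ξ‖ ^ 2)) := fun ξ => by
    funext j; simp only [F, G]; ring
  have hpt : ∀ ξ, ‖m ξ * (densityTransform μ h ξ * conj (densityTransform μ g ξ))‖ₑ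
      ≤ ∑' j, ENNReal.ofReal (F j ξ) := by
    intro ξ
    have hs := (summable_gaussianWeight hq hq1 ξ).mul_right
      (M * (‖densityTransform μ g ξ‖ ^ 2 + ‖densityTransform μ h ξ‖ ^ 2))
    rw [← ENNReal.ofReal_tsum_of_nonneg (fun j => hF0 j ξ) (by rw [hF]; exact hs), hF,
      tsum_mul_right, ← ofReal_norm]
    refine ENNReal.ofReal_le_ofReal ?_
    rw [norm_mul, norm_mul, RCLike.norm_conj]
    have hw : 0 ≤ gaussianWeight q ξ := tsum_nonneg fun j => by positivity
    calc _ ≤ (M * gaussianWeight q ξ) *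
          (‖densityTransform μ g ξ‖ ^ 2 + ‖densityTransform μ h ξ‖ ^ 2) := by
          refine mul_le_mul (hm ξ) ?_ (by positivity) (by positivity)
          nlinarith [sq_nonneg (‖densityTransform μ g ξ‖ - ‖densityTransform μ h ξ‖),
            sq_nonneg (‖densityTransform μ g ξ‖), sq_nonneg (‖densityTransform μ h ξ‖)]
      _ = _ := by rw [gaussianWeight]; ring
  have hcg : ∀ {f : V → ℝ}, Measurable f → (∀ x, |f x| ≤ B) → ∀ j,
      Integrable (fun ξ => G j ξ * ‖densityTransform μ f ξ‖ ^ 2) := fun {f} hf hfB j => by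
    refine (integrable_gaussian (V := V) (R := 2 ^ j) (by positivity)).mul_bdd
      (c := (B * μ.real univ) ^ 2)
      ((continuous_densityTransform hf hfB).norm.pow 2).aestronglyMeasurable
      (Filter.Eventually.of_forall fun ξ => ?_)
    rw [norm_pow, norm_norm]
    exact pow_le_pow_left₀ (norm_nonneg _) (norm_densityTransform_le hfB ξ) 2
  have henergy : ∀ {f : V → ℝ}, Measurable f → (∀ x, |f x| ≤ B) → ∀ j,
      q ^ j * ∫ ξ, G j ξ * ‖densityTransform μ f ξ‖ ^ 2 ≤ q' ^ j * (C * T) * ∫ x, f x ^ 2 ∂μ := by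
    intro f hf hfB j
    have h2 : (0 : ℝ) < 2 ^ j := by positivity
    have h1 := integral_gaussian_mul_norm_sq_le (μ := μ) h2
      (integral_exp_neg_norm_sub_sq_le hC hball h2) hf hfB
    refine (mul_le_mul_of_nonneg_left h1 (pow_nonneg hq j)).trans (le_of_eq ?_)
    have e1 : ((2 : ℝ) ^ j) ^ (-s) = (2 ^ (-s)) ^ j := by
      rw [← Real.rpow_natCast, ← Real.rpow_natCast, ← Real.rpow_mul two_pos.le,
        ← Real.rpow_mul two_pos.le, mul_comm]
    have e2 : ((2 : ℝ) ^ j) ^ Module.finrank ℝ V = (2 ^ (Module.finrank ℝ V : ℝ)) ^ j := by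
      rw [Real.rpow_natCast, pow_right_comm]
    rw [e1, e2, hq', mul_pow, mul_pow, ← hT]
    ring
  have hterm : ∀ j, ∫⁻ ξ, ENNReal.ofReal (F j ξ) ≤ ENNReal.ofReal (q' ^ j * (M * (C * T) * N)) := by
    intro j
    have hFi : Integrable (F j) := ((hcg hg hgB j).add (hcg hh hhB j)).const_mul _
    rw [← ofReal_integral_eq_lintegral_ofReal hFi
      (Filter.Eventually.of_forall fun ξ => hF0 j ξ)]
    refine ENNReal.ofReal_le_ofReal ?_
    simp only [F]
    rw [integral_const_mul, integral_add (hcg hg hgB j) (hcg hh hhB j)]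
    calc _ = M * (q ^ j * (∫ ξ, G j ξ * ‖densityTransform μ g ξ‖ ^ 2)
          + q ^ j * ∫ ξ, G j ξ * ‖densityTransform μ h ξ‖ ^ 2) := by ring
      _ ≤ M * (q' ^ j * (C * T) * (∫ x, g x ^ 2 ∂μ) + q' ^ j * (C * T) * ∫ x, h x ^ 2 ∂μ) :=
          mul_le_mul_of_nonneg_left (add_le_add (henergy hg hgB j) (henergy hh hhB j)) hM
      _ = _ := by rw [hN]; ring
  have hfin : ‖∫ ξ, m ξ * (densityTransform μ h ξ * conj (densityTransform μ g ξ))‖ₑ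
      ≤ ENNReal.ofReal (A * N) :=
    calc _ ≤ ∫⁻ ξ, ‖m ξ * (densityTransform μ h ξ * conj (densityTransform μ g ξ))‖ₑ :=
          enorm_integral_le_lintegral_enorm _
      _ ≤ ∫⁻ ξ, ∑' j, ENNReal.ofReal (F j ξ) := lintegral_mono hpt
      _ = ∑' j, ∫⁻ ξ, ENNReal.ofReal (F j ξ) := lintegral_tsum fun j =>
          ((((hcg hg hgB j).add (hcg hh hhB j)).const_mul _).aestronglyMeasurable.aemeasurable).ennreal_ofReal
      _ ≤ ∑' j, ENNReal.ofReal (q' ^ j * (M * (C * T) * N)) := ENNReal.tsum_le_tsum hterm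
      _ = ENNReal.ofReal (∑' j : ℕ, q' ^ j * (M * (C * T) * N)) :=
          (ENNReal.ofReal_tsum_of_nonneg (fun j => by positivity)
            ((summable_geometric_of_lt_one hq'0 hqs).mul_right _)).symm
      _ = ENNReal.ofReal (A * N) := by
          rw [tsum_mul_right, tsum_geometric_of_lt_one hq'0 hqs, hA]; congr 1; ring
  rw [← ofReal_norm, ENNReal.ofReal_le_ofReal_iff (by positivity)] at hfin
  have : 0 ≤ N := by positivity
  linarith

/-- Convolution with a bounded kernel whose multiplier is dominated by `gaussianWeight q` is bounded
on `L²(μ)`, with a bound depending only on the domination constant. -/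
theorem exists_integral_convolution_sq_le {C s : ℝ} (hC : 0 < C)
    (hball : ∀ (x : V) (r : ℝ), 0 < r → μ (closedBall x r) ≤ ENNReal.ofReal (C * r ^ s))
    {q : ℝ} (hq : 0 ≤ q) (hq1 : q < 1) (hqs : q * 2 ^ (Module.finrank ℝ V : ℝ) * 2 ^ (-s) < 1)
    {M : ℝ} (hM : 0 ≤ M) :
    ∃ A, 0 < A ∧ ∀ (m : V → ℂ) (K : V → ℝ), Integrable m → (∀ ξ, ‖m ξ‖ ≤ M * gaussianWeight q ξ) →
      (∀ z, (K z : ℂ) = ∫ ξ, m ξ * planeWave ξ z) → Measurable K → ∀ L, (∀ z, |K z| ≤ L) →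
      ∀ g : V → ℝ, Measurable g → ∀ B, (∀ x, |g x| ≤ B) →
        ∫ x, (∫ y, K (x - y) * g y ∂μ) ^ 2 ∂μ ≤ A * ∫ x, g x ^ 2 ∂μ := by
  obtain ⟨A, hA, H⟩ := exists_norm_integral_multiplier_le hC hball hq hq1 hqs hM
  refine ⟨4 * A ^ 2, by positivity, fun m K hm hmw hK hKm L hL g hg B hB => ?_⟩
  let h : V → ℝ := fun x => ∫ y, K (x - y) * g y ∂μ
  have hKg : Measurable fun p : V × V => K (p.1 - p.2) * g p.2 := by fun_prop
  have hh : Measurable h := (hKg.stronglyMeasurable.integral_prod_right).measurable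
  have hB0 : 0 ≤ B := (abs_nonneg _).trans (hB 0)
  have hL0 : 0 ≤ L := (abs_nonneg _).trans (hL 0)
  have hKgB : ∀ x y, |K (x - y) * g y| ≤ L * B := fun x y => by
    rw [abs_mul]; exact mul_le_mul (hL _) (hB _) (abs_nonneg _) hL0
  have hhB : ∀ x, |h x| ≤ L * B * μ.real univ := fun x => by
    rw [← Real.norm_eq_abs]
    exact norm_integral_le_of_norm_le_const (Filter.Eventually.of_forall fun y => hKgB x y)
  let g' : V → ℝ := fun x => 2 * A * g x
  have hg' : Measurable g' := hg.const_mul _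
  set B' := max (2 * A * B) (L * B * μ.real univ)
  have hg'B : ∀ x, |g' x| ≤ B' := fun x => by
    refine le_trans ?_ (le_max_left _ _)
    rw [abs_mul, abs_of_pos (by positivity : 0 < 2 * A)]
    exact mul_le_mul_of_nonneg_left (hB x) (by positivity)
  have key := H m hmw g' h hg' hh B' hg'B fun x => (hhB x).trans (le_max_right _ _)
  rw [← integral_kernel_eq_integral_multiplier hm hK hg' hh hg'B
    fun x => (hhB x).trans (le_max_right _ _)] at key
  have hint : Integrable (fun p : V × V => K (p.1 - p.2) * (h p.1 * g' p.2)) (μ.prod μ) := by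
    refine Integrable.of_bound (Measurable.aestronglyMeasurable (by fun_prop)) (L * (B' * B'))
      (Filter.Eventually.of_forall fun p => ?_)
    rw [norm_mul, norm_mul]
    have hb := (hhB p.1).trans (le_max_right (2 * A * B) _)
    exact mul_le_mul (hL _) (mul_le_mul hb (hg'B _) (norm_nonneg _) ((abs_nonneg _).trans hb))
      (by positivity) hL0
  have hform : ∫ p : V × V, (K (p.1 - p.2) : ℂ) * (h p.1 * g' p.2 : ℝ) ∂(μ.prod μ)
      = ((2 * A * ∫ x, h x ^ 2 ∂μ : ℝ) : ℂ) := by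
    have : ∫ p : V × V, K (p.1 - p.2) * (h p.1 * g' p.2) ∂(μ.prod μ) = 2 * A * ∫ x, h x ^ 2 ∂μ := by
      rw [integral_prod _ hint, ← integral_const_mul]
      refine integral_congr_ae (Filter.Eventually.of_forall fun x => ?_)
      simp only [g']
      rw [show (fun y => K (x - y) * (h x * (2 * A * g y)))
        = fun y => (2 * A * h x) * (K (x - y) * g y) by funext y; ring, integral_const_mul]
      simp only [h]
      ring
    rw [← this, ← integral_complex_ofReal]
    refine integral_congr_ae (Filter.Eventually.of_forall fun p => ?_)
    push_cast
    rfl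
  have hh0 : 0 ≤ ∫ x, h x ^ 2 ∂μ := integral_nonneg fun x => sq_nonneg _
  have hg2 : ∫ x, g' x ^ 2 ∂μ = 4 * A ^ 2 * ∫ x, g x ^ 2 ∂μ := by
    rw [← integral_const_mul]
    refine integral_congr_ae (Filter.Eventually.of_forall fun x => ?_)
    simp only [g']; ring
  rw [hform, Complex.norm_real, Real.norm_of_nonneg (by positivity), hg2] at key
  have : A * ∫ x, h x ^ 2 ∂μ ≤ A * (4 * A ^ 2 * ∫ x, g x ^ 2 ∂μ) := by linarith
  exact le_of_mul_le_mul_left this hA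

end Energy

section Multiplier

open scoped ComplexConjugate FourierTransform SchwartzMap

variable {V : Type*} [NormedAddCommGroup V] [InnerProductSpace ℝ V] [MeasurableSpace V]
  [BorelSpace V]

theorem continuous_integral_mul_planeWave [SecondCountableTopology V] {ν : Measure V} {m : V → ℂ}
    (hm : Integrable m ν) : Continuous fun z => ∫ ξ, m ξ * planeWave ξ z ∂ν := by
  refine continuous_of_dominated (bound := fun ξ => ‖m ξ‖) (fun z => ?_)
    (fun z => Filter.Eventually.of_forall fun ξ => ?_) hm.norm
    (Filter.Eventually.of_forall fun ξ => by fun_prop)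
  · exact hm.aestronglyMeasurable.mul (by fun_prop : Continuous _).aestronglyMeasurable
  · rw [norm_mul, norm_planeWave, mul_one]

variable [FiniteDimensional ℝ V]

/-- Fourier inversion for test functions. -/
theorem exists_eq_integral_mul_planeWave {ρ : V → ℝ} (hρ : ContDiff ℝ (⊤ : ℕ∞) ρ)
    (hρ_supp : HasCompactSupport ρ) :
    ∃ φ : V → ℂ, Continuous φ ∧ Integrable φ ∧ (∀ ξ, ‖φ ξ‖ ≤ ∫ x, ‖ρ x‖) ∧
      ∀ x, (ρ x : ℂ) = ∫ ξ, φ ξ * planeWave ξ x := by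
  let f : 𝓢(V, ℂ) := HasCompactSupport.toSchwartzMap (f := fun x => (ρ x : ℂ))
    (hρ_supp.comp_left Complex.ofReal_zero) (Complex.ofRealCLM.contDiff.comp hρ)
  refine ⟨(𝓕 f : 𝓢(V, ℂ)), (𝓕 f).continuous, (𝓕 f).integrable, fun ξ => ?_, fun x => ?_⟩
  · rw [SchwartzMap.fourier_coe]
    refine (VectorFourier.norm_fourierIntegral_le_integral_norm _ _ _ _ _).trans (le_of_eq ?_)
    refine integral_congr_ae (Filter.Eventually.of_forall fun y => ?_)
    exact Complex.norm_real _
  · have h1 : 𝓕⁻ (𝓕 f) x = f x := by rw [FourierTransform.fourierInv_fourier_eq]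
    rw [SchwartzMap.fourierInv_coe, Real.fourierInv_eq'] at h1
    change f x = _
    rw [← h1]
    refine integral_congr_ae (Filter.Eventually.of_forall fun ξ => ?_)
    simp only [planeWave, smul_eq_mul]
    rw [mul_comm]

/-- The multiplier of a mollified measure is dominated by the Fourier transform of the measure. -/
theorem exists_multiplier_mollified (σ : Measure V) [IsFiniteMeasure σ] {ρ : V → ℝ}
    (hρ : ContDiff ℝ (⊤ : ℕ∞) ρ) (hρ_supp : HasCompactSupport ρ) {ε : ℝ} (hε : 0 < ε) :
    ∃ m : V → ℂ, Integrable m ∧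
      (∀ ξ, ‖m ξ‖ ≤ (∫ x, ‖ρ x‖) * ‖∫ y, planeWave ξ y ∂σ‖) ∧
      ∀ z, ((∫ y, (ε ^ Module.finrank ℝ V)⁻¹ * ρ (ε⁻¹ • (z - y)) ∂σ : ℝ) : ℂ)
        = ∫ ξ, m ξ * planeWave ξ z := by
  obtain ⟨φ, hφc, hφi, hφb, hφ⟩ := exists_eq_integral_mul_planeWave hρ hρ_supp
  have hφε : Integrable fun ξ => φ (ε • ξ) := hφi.comp_smul hε.ne'
  have hscale : ∀ z, (((ε ^ Module.finrank ℝ V)⁻¹ * ρ (ε⁻¹ • z) : ℝ) : ℂ)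
      = ∫ ξ, φ (ε • ξ) * planeWave ξ z := fun z => by
    have h := Measure.integral_comp_smul volume (fun ξ => φ ξ * planeWave ξ (ε⁻¹ • z)) ε
    rw [← hφ, abs_of_nonneg (by positivity)] at h
    rw [Complex.ofReal_mul, ← Complex.real_smul, ← h]
    refine integral_congr_ae (Filter.Eventually.of_forall fun ξ => ?_)
    simp only [planeWave]
    rw [real_inner_smul_left, real_inner_smul_right, mul_inv_cancel_left₀ hε.ne']
  let s : V → ℂ := fun ξ => conj (∫ y, planeWave ξ y ∂σ)
  have hs : ∀ ξ, ‖s ξ‖ = ‖∫ y, planeWave ξ y ∂σ‖ := fun ξ => RCLike.norm_conj _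
  have hsb : ∀ ξ, ‖s ξ‖ ≤ 1 * σ.real univ := fun ξ => by
    rw [hs]
    exact norm_integral_le_of_norm_le_const
      (Filter.Eventually.of_forall fun y => (norm_planeWave ξ y).le)
  have hsc : Continuous s := by
    refine Complex.continuous_conj.comp (continuous_of_dominated
      (fun ξ => (by fun_prop : Continuous _).aestronglyMeasurable)
      (fun ξ => Filter.Eventually.of_forall fun y => (norm_planeWave ξ y).le) (integrable_const 1)
      (Filter.Eventually.of_forall fun y => by fun_prop))
  refine ⟨fun ξ => φ (ε • ξ) * s ξ, hφε.mul_bdd hsc.aestronglyMeasurable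
    (Filter.Eventually.of_forall hsb), fun ξ => ?_, fun z => ?_⟩
  · rw [norm_mul, hs]
    exact mul_le_mul_of_nonneg_right (hφb _) (norm_nonneg _)
  · rw [← integral_complex_ofReal]
    simp only [hscale]
    have hint : Integrable (Function.uncurry fun (y ξ : V) => φ (ε • ξ) * planeWave ξ (z - y))
        (σ.prod volume) := by
      refine (hφε.comp_snd σ).mul_bdd (c := 1) (g := fun p : V × V => planeWave p.2 (z - p.1))
        (by fun_prop : Continuous _).aestronglyMeasurable (Filter.Eventually.of_forall fun p => ?_)
      exact (norm_planeWave _ _).le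
    rw [integral_integral_swap hint]
    refine integral_congr_ae (Filter.Eventually.of_forall fun ξ => ?_)
    simp only [s]
    rw [← integral_conj, integral_const_mul, mul_assoc, ← integral_mul_const]
    congr 1
    refine integral_congr_ae (Filter.Eventually.of_forall fun y => ?_)
    simp only [planeWave_sub]
    ring

end Multiplier

/-- The mollified sphere averages are bounded on bounded functions in `L²(μ)`, uniformly in the
mollification parameter. -/
theorem exists_integral_mollifiedSphere_sq_le {d : ℕ} (hd : 2 ≤ d) {t : ℝ} (ht : 0 < t)
    (μ : Measure (EuclideanSpace ℝ (Fin d))) [IsFiniteMeasure μ] {C s : ℝ} (hC : 0 < C)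
    (hs : ((d : ℝ) + 1) / 2 < s)
    (hball : ∀ (x : EuclideanSpace ℝ (Fin d)) (r : ℝ), 0 < r →
      μ (closedBall x r) ≤ ENNReal.ofReal (C * r ^ s))
    {ρ : EuclideanSpace ℝ (Fin d) → ℝ} (hρ : ContDiff ℝ (⊤ : ℕ∞) ρ)
    (hρ_supp : HasCompactSupport ρ) :
    ∃ A, 0 < A ∧ ∀ ε > 0, Measurable (mollifiedSphere d t ε ρ) ∧
      (∃ L, ∀ z, |mollifiedSphere d t ε ρ z| ≤ L) ∧
      ∀ g : EuclideanSpace ℝ (Fin d) → ℝ, Measurable g → ∀ B, (∀ x, |g x| ≤ B) →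
        ∫ x, (∫ y, mollifiedSphere d t ε ρ (x - y) * g y ∂μ) ^ 2 ∂μ ≤ A * ∫ x, g x ^ 2 ∂μ := by
  obtain ⟨n, rfl⟩ : ∃ n, d = n + 1 := ⟨d - 1, by omega⟩
  have := isFiniteMeasure_sphereMeasure hd ht
  obtain ⟨D, hD⟩ := exists_norm_integral_cexp_le (sphereMeasure (n + 1) t)
    (map_sphereMeasure (n + 1) t) ht (sphereMeasure_ae_norm_eq (n + 1) t)
    (EuclideanSpace.basisFun (Fin (n + 1)) ℝ)
  set σ := sphereMeasure (n + 1) t with hσ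
  set q : ℝ := 2 ^ (-(n : ℝ) / 2) with hq
  have hn : (1 : ℝ) ≤ n := by exact_mod_cast (by omega : 1 ≤ n)
  have hq0 : 0 ≤ q := by positivity
  have hq1 : q < 1 := Real.rpow_lt_one_of_one_lt_of_neg one_lt_two (by linarith)
  have hqn : q ^ 2 * 2 ^ n = 1 := by
    rw [hq, ← Real.rpow_natCast, ← Real.rpow_natCast, ← Real.rpow_mul two_pos.le,
      ← Real.rpow_add two_pos, ← Real.rpow_zero 2]
    congr 1
    push_cast; ring
  have hqs : q * 2 ^ (Module.finrank ℝ (EuclideanSpace ℝ (Fin (n + 1))) : ℝ) * 2 ^ (-s) < 1 := by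
    rw [hq, finrank_euclideanSpace_fin, ← Real.rpow_add two_pos, ← Real.rpow_add two_pos]
    refine Real.rpow_lt_one_of_one_lt_of_neg one_lt_two ?_
    push_cast at hs ⊢
    linarith
  set S : ℝ := σ.real univ
  have hbound : ∀ ξ, ‖∫ y, planeWave ξ y ∂σ‖
      ≤ Real.exp (4 * Real.pi) * (S + √D) * gaussianWeight q ξ :=
    le_gaussianWeight_of_decay hq0 hq1 hqn (fun ξ => (norm_integral_le_of_norm_le_const
      (Filter.Eventually.of_forall fun y => (norm_planeWave ξ y).le)).trans_eq (one_mul _))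
      measureReal_nonneg hD
  set N : ℝ := ∫ x, ‖ρ x‖
  have hN : 0 ≤ N := integral_nonneg fun x => norm_nonneg _
  have hS : 0 ≤ S := measureReal_nonneg
  obtain ⟨A, hA, H⟩ := exists_integral_convolution_sq_le (μ := μ) hC hball hq0 hq1 hqs
    (M := N * (Real.exp (4 * Real.pi) * (S + √D))) (by positivity)
  refine ⟨A, hA, fun ε hε => ?_⟩
  obtain ⟨m, hm, hmb, hmK⟩ := exists_multiplier_mollified σ hρ hρ_supp hε
  have hK : ∀ z, (mollifiedSphere (n + 1) t ε ρ z : ℂ) = ∫ ξ, m ξ * planeWave ξ z := fun z => by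
    rw [← hmK, finrank_euclideanSpace_fin]; rfl
  have hKm : Measurable (mollifiedSphere (n + 1) t ε ρ) := by
    have h := Complex.continuous_re.comp (continuous_integral_mul_planeWave hm)
    simp only [← hK] at h
    exact h.measurable
  have hKL : ∀ z, |mollifiedSphere (n + 1) t ε ρ z| ≤ ∫ ξ, ‖m ξ‖ := fun z => by
    rw [← Real.norm_eq_abs, ← Complex.norm_real, hK]
    refine (norm_integral_le_integral_norm _).trans (le_of_eq ?_)
    simp only [norm_mul, norm_planeWave, mul_one]
  refine ⟨hKm, ⟨_, hKL⟩, H m _ hm (fun ξ => ?_) hK hKm _ hKL⟩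
  rw [mul_assoc]
  exact (hmb ξ).trans (mul_le_mul_of_nonneg_left (hbound ξ) hN)

/-- Iterating a kernel that is bounded on `L²(μ)`. -/
theorem chainFn_measurable_bounded_integral_sq_le {d : ℕ} (μ : Measure (EuclideanSpace ℝ (Fin d)))
    [IsProbabilityMeasure μ] {K : EuclideanSpace ℝ (Fin d) → ℝ} (hK : Measurable K) {L : ℝ}
    (hL : ∀ z, |K z| ≤ L) {A : ℝ} (hA : 0 ≤ A)
    (H : ∀ g : EuclideanSpace ℝ (Fin d) → ℝ, Measurable g → ∀ B, (∀ x, |g x| ≤ B) →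
      ∫ x, (∫ y, K (x - y) * g y ∂μ) ^ 2 ∂μ ≤ A * ∫ x, g x ^ 2 ∂μ) (k : ℕ) :
    Measurable (chainFn μ K k) ∧ (∃ B, ∀ x, |chainFn μ K k x| ≤ B) ∧
      ∫ x, chainFn μ K k x ^ 2 ∂μ ≤ A ^ (k + 1) := by
  have step : ∀ g : EuclideanSpace ℝ (Fin d) → ℝ, Measurable g → (∃ B, ∀ x, |g x| ≤ B) →
      Measurable (fun x => ∫ y, K (x - y) * g y ∂μ) ∧
        ∃ B, ∀ x, |∫ y, K (x - y) * g y ∂μ| ≤ B := by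
    rintro g hg ⟨B, hB⟩
    have hKg : Measurable fun p : EuclideanSpace ℝ (Fin d) × EuclideanSpace ℝ (Fin d) =>
      K (p.1 - p.2) * g p.2 := by fun_prop
    refine ⟨hKg.stronglyMeasurable.integral_prod_right.measurable, L * B * μ.real univ,
      fun x => ?_⟩
    rw [← Real.norm_eq_abs]
    refine norm_integral_le_of_norm_le_const (Filter.Eventually.of_forall fun y => ?_)
    rw [norm_mul]
    exact mul_le_mul (hL _) (hB _) (norm_nonneg _) ((abs_nonneg _).trans (hL 0))
  induction k with
  | zero =>
    have h0 : chainFn μ K 0 = fun x => ∫ y, K (x - y) * (fun _ => (1 : ℝ)) y ∂μ := by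
      funext x; simp only [chainFn, mul_one]
    obtain ⟨h1, h2⟩ := step (fun _ => 1) measurable_const ⟨1, fun x => by simp⟩
    rw [h0]
    exact ⟨h1, h2, (H (fun _ => 1) measurable_const 1 fun x => by simp).trans (by simp)⟩
  | succ k ih =>
    obtain ⟨hm, ⟨B, hB⟩, hle⟩ := ih
    obtain ⟨h1, h2⟩ := step _ hm ⟨B, hB⟩
    refine ⟨h1, h2, (H _ hm B hB).trans ?_⟩
    rw [pow_succ' A (k + 1)]
    exact mul_le_mul_of_nonneg_left hle hA

theorem eLpNorm_two_le_ofReal_sqrt {X : Type*} [MeasurableSpace X] {μ : Measure X}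
    [IsFiniteMeasure μ] {f : X → ℝ} (hf : Measurable f) {B : ℝ} (hB : ∀ x, |f x| ≤ B) {A : ℝ}
    (hA : ∫ x, f x ^ 2 ∂μ ≤ A) : eLpNorm f 2 μ ≤ ENNReal.ofReal √A := by
  have hfp : MemLp f 2 μ := MemLp.of_bound hf.aestronglyMeasurable B
    (Filter.Eventually.of_forall hB)
  rw [hfp.eLpNorm_eq_integral_rpow_norm two_ne_zero ENNReal.ofNat_ne_top]
  refine ENNReal.ofReal_le_ofReal ?_
  rw [Real.sqrt_eq_rpow]
  simp only [ENNReal.toReal_ofNat, Real.rpow_ofNat, Real.norm_eq_abs, sq_abs]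
  rw [one_div]
  exact Real.rpow_le_rpow (integral_nonneg fun x => sq_nonneg _) hA (by norm_num)

/-- Let `d ≥ 2`, `t > 0`, and let `μ` be a compactly supported Borel
probability measure on `ℝ^d` with `μ(B(x,r)) ≤ C r^s`, `s > (d+1)/2`. With
`f_1 = σ_t^ε * μ` and `f_k = σ_t^ε * (f_{k-1} μ)` for `k ≥ 2`, for every `k ≥ 1` there is a
constant `C(k)`, independent of `ε ∈ (0,1)`, such that `‖f_k‖_{L²(μ)} ≤ C(k)`. -/
theorem chain_functions_L2_bound
    (d : ℕ) (hd : 2 ≤ d) (t : ℝ) (ht : 0 < t)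
    (μ : Measure (EuclideanSpace ℝ (Fin d))) [IsProbabilityMeasure μ]
    (hμc : ∃ K : Set (EuclideanSpace ℝ (Fin d)), IsCompact K ∧ μ Kᶜ = 0)
    (C s : ℝ) (hC : 0 < C) (hs : ((d : ℝ) + 1) / 2 < s)
    (hball : ∀ (x : EuclideanSpace ℝ (Fin d)) (r : ℝ), 0 < r →
      μ (closedBall x r) ≤ ENNReal.ofReal (C * r ^ s))
    (ρ : EuclideanSpace ℝ (Fin d) → ℝ) (hρ_smooth : ContDiff ℝ (⊤ : ℕ∞) ρ)
    (hρ_supp : HasCompactSupport ρ) (hρ_nonneg : ∀ x, 0 ≤ ρ x)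
    (hρ_int : ∫ x, ρ x = 1) :
    ∀ k : ℕ, ∃ Ck : ℝ, 0 < Ck ∧ ∀ ε ∈ Set.Ioo (0 : ℝ) 1,
      eLpNorm (chainFn μ (mollifiedSphere d t ε ρ) k) 2 μ ≤ ENNReal.ofReal Ck := by
  intro k
  obtain ⟨A, hA, H⟩ := exists_integral_mollifiedSphere_sq_le hd ht μ hC hs hball hρ_smooth hρ_supp
  refine ⟨√(A ^ (k + 1)), by positivity, fun ε hε => ?_⟩
  obtain ⟨hKm, ⟨L, hL⟩, hK⟩ := H ε hε.1
  obtain ⟨hm, ⟨B, hB⟩, hle⟩ := chainFn_measurable_bounded_integral_sq_le μ hKm hL hA.le hK k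
  exact eLpNorm_two_le_ofReal_sqrt hm hB hle
end
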